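/- Let μ be a uniformly distributed measure on ℝ^d with distribution function φ. Then there exist integers n and p with 0 ≤ n, p ≤ d such that lim_{r→0⁺} φ(r)/rⁿ and lim_{r→∞} φ(r)/r^p both exist and are finite and positive. -/

import Mathlib

open MeasureTheory Metric Filter Set

noncomputable section

abbrev Euc (d : ℕ) : Type := EuclideanSpace ℝ (Fin d)

/-- The support of a measure: points all of whose closed balls have positive measure. -/
def msupport {d : ℕ} (μ : Measure (Euc d)) : Set (Euc d) :=
  {x | ∀ r : ℝ, 0 < r → 0 < μ (Metric.closedBall x r)}

/-- `φ` is a distribution function of the uniformly distributed measure `μ`. -/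
def IsDistributionFunction {d : ℕ} (μ : Measure (Euc d)) (φ : ℝ → ENNReal) : Prop :=
  (msupport μ).Nonempty ∧
  (∀ r : ℝ, 0 < r → 0 < φ r ∧ φ r < ⊤) ∧
  (∀ x ∈ msupport μ, ∀ r : ℝ, 0 < r → μ (Metric.closedBall x r) = φ r)

/-- `μ` is uniformly distributed. -/
def UniformlyDistributed {d : ℕ} (μ : Measure (Euc d)) : Prop :=
  ∃ φ : ℝ → ENNReal, IsDistributionFunction μ φ

/-- `dim₀ μ = n` : the limit of `φ(r)/rⁿ` as `r → 0⁺` exists, is finite and positive. -/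
def HasDim0 (φ : ℝ → ENNReal) (n : ℕ) : Prop :=
  ∃ c : ℝ, 0 < c ∧
    Filter.Tendsto (fun r : ℝ => (φ r).toReal / r ^ n) (nhdsWithin 0 (Set.Ioi 0)) (nhds c)

/-- `dim_∞ μ = p` : the limit of `φ(r)/r^p` as `r → ∞` exists, is finite and positive. -/
def HasDimInfty (φ : ℝ → ENNReal) (p : ℕ) : Prop :=
  ∃ c : ℝ, 0 < c ∧
    Filter.Tendsto (fun r : ℝ => (φ r).toReal / r ^ p) Filter.atTop (nhds c)

/-- The affine `n`-planes of `ℝ^d`. -/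
def nPlanes (d n : ℕ) : Set (AffineSubspace ℝ (Euc d)) :=
  {L | (L : Set (Euc d)).Nonempty ∧ Module.finrank ℝ L.direction = n}

/-- Jones' beta number `β^n_μ(B(x,r))`. -/
def jonesBeta {d : ℕ} (n : ℕ) (μ : Measure (Euc d)) (x : Euc d) (r : ℝ) : ℝ :=
  ⨅ L : nPlanes d n,
    ⨆ y : (msupport μ ∩ Metric.closedBall x r : Set (Euc d)),
      Metric.infDist y.1 (L.1 : Set (Euc d)) / r

/-- The bilateral beta number `bβ^n_μ(B(x,r))`. -/
def bilateralBeta {d : ℕ} (n : ℕ) (μ : Measure (Euc d)) (x : Euc d) (r : ℝ) : ℝ :=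
  ⨅ L : nPlanes d n,
    ((⨆ y : (msupport μ ∩ Metric.closedBall x r : Set (Euc d)),
        Metric.infDist y.1 (L.1 : Set (Euc d)) / r) +
     (⨆ p : ((L.1 : Set (Euc d)) ∩ Metric.closedBall x r : Set (Euc d)),
        Metric.infDist p.1 (msupport μ) / r))

/-- `μ` is doubling with constant `C`. -/
def DoublingWith {d : ℕ} (μ : Measure (Euc d)) (C : ℝ) : Prop :=
  ∀ x ∈ msupport μ, ∀ r : ℝ, 0 < r →
    μ (Metric.closedBall x (2 * r)) ≤ ENNReal.ofReal C * μ (Metric.closedBall x r)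

/-- `μ` is doubling. -/
def Doubling {d : ℕ} (μ : Measure (Euc d)) : Prop :=
  ∃ C : ℝ, 0 < C ∧ DoublingWith μ C

/-- Weak convergence of a sequence of Radon measures. -/
def WeakConv {d : ℕ} (μs : ℕ → Measure (Euc d)) (μ : Measure (Euc d)) : Prop :=
  ∀ f : Euc d → ℝ, Continuous f → HasCompactSupport f →
    Filter.Tendsto (fun j => ∫ x, f x ∂(μs j)) Filter.atTop (nhds (∫ x, f x ∂μ))

/-- `μ` is `n`-asymptotically optimally doubling. -/
def AsympOptDoubling {d : ℕ} (n : ℕ) (μ : Measure (Euc d)) : Prop :=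
  ∀ K : Set (Euc d), IsCompact K → K ⊆ msupport μ →
    ∀ t : ℝ, t ∈ Set.Icc (1/2 : ℝ) 1 →
      Filter.Tendsto
        (fun r : ℝ => ⨆ x : K,
          |(μ (Metric.closedBall x.1 (t * r)) / μ (Metric.closedBall x.1 r)).toReal - t ^ n|)
        (nhdsWithin 0 (Set.Ioi 0)) (nhds 0)

/-- Truncated `n`-Riesz transform `R_{r,s}μ(z)`. -/
def rieszT {d : ℕ} (n : ℕ) (μ : Measure (Euc d)) (z : Euc d) (r s : ℝ) : Euc d :=
  ∫ y in {y : Euc d | r ≤ dist y z ∧ dist y z ≤ s}, (‖y - z‖ ^ (n + 1))⁻¹ • (y - z) ∂μ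

/-- `μ` is locally Ahlfors `n`-regular. -/
def LocallyAhlforsRegular {d : ℕ} (n : ℕ) (μ : Measure (Euc d)) : Prop :=
  ∀ K : Set (Euc d), IsCompact K → ∃ c : ℝ, 0 < c ∧ ∃ rK : ℝ, 0 < rK ∧
    ∀ x ∈ msupport μ ∩ K, ∀ r : ℝ, 0 < r → r ≤ rK →
      ENNReal.ofReal (c⁻¹ * r ^ n) ≤ μ (Metric.closedBall x r) ∧
      μ (Metric.closedBall x r) ≤ ENNReal.ofReal (c * r ^ n)

/-- `μ` is locally uniformly `n`-rectifiable. -/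
def LocUnifRectifiable {d : ℕ} (n : ℕ) (μ : Measure (Euc d)) : Prop :=
  LocallyAhlforsRegular n μ ∧
  ∀ K : Set (Euc d), IsCompact K →
    ∃ RK θK MK : ℝ, 0 < RK ∧ 0 < θK ∧ 0 < MK ∧
      ∀ x ∈ msupport μ ∩ K, ∀ R : ℝ, 0 < R → R ≤ RK →
        ∃ g : EuclideanSpace ℝ (Fin n) → Euc d,
          LipschitzWith (Real.toNNReal MK) g ∧
          ENNReal.ofReal (θK * R ^ n) ≤ μ (Metric.closedBall x R ∩ Set.range g)

theorem msupport_eq_support {d : ℕ} (μ : Measure (Euc d)) : msupport μ = μ.support := by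
  ext x
  exact (Filter.HasBasis.mem_measureSupport Metric.nhds_basis_closedBall).symm

theorem isClosed_msupport {d : ℕ} (μ : Measure (Euc d)) : IsClosed (msupport μ) := by
  rw [msupport_eq_support]
  exact Measure.isClosed_support

theorem ae_mem_msupport {d : ℕ} (μ : Measure (Euc d)) : ∀ᵐ x ∂μ, x ∈ msupport μ := by
  rw [msupport_eq_support]
  exact Measure.support_mem_ae

namespace IsDistributionFunction

variable {d : ℕ} {μ : Measure (Euc d)} {φ : ℝ → ENNReal}

theorem mono (hφ : IsDistributionFunction μ φ) {r s : ℝ} (hr : 0 < r) (hrs : r ≤ s) :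
    φ r ≤ φ s := by
  obtain ⟨x, hx⟩ := hφ.1
  rw [← hφ.2.2 x hx r hr, ← hφ.2.2 x hx s (hr.trans_le hrs)]
  exact measure_mono (closedBall_subset_closedBall hrs)

theorem two_mul_le (hφ : IsDistributionFunction μ φ) {r : ℝ} (hr : 0 < r) :
    φ (2 * r) ≤ 5 ^ d * φ r := by
  classical
  obtain ⟨x, hx⟩ := hφ.1
  let P : ℕ → Prop := fun n => ∃ s : Finset (Euc d), s.card = n ∧
    (∀ c ∈ s, c ∈ msupport μ ∧ ‖c - x‖ ≤ 2 * r) ∧ ∀ c ∈ s, ∀ e ∈ s, c ≠ e → r ≤ ‖c - e‖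
  have hbound : ∀ n, P n → n ≤ 5 ^ d := by
    rintro n ⟨s, rfl, hs, hsep⟩
    let g : Euc d → Euc d := fun c => r⁻¹ • (c - x)
    have hg : Function.Injective g := by
      intro a b hab
      have := smul_right_injective (Euc d) (inv_ne_zero hr.ne') hab
      simpa using this
    have := Besicovitch.card_le_of_separated (s.image g) ?_ ?_
    · rwa [Finset.card_image_of_injective _ hg, finrank_euclideanSpace_fin] at this
    · intro c hc
      obtain ⟨a, ha, rfl⟩ := Finset.mem_image.1 hc
      simp only [g, norm_smul, norm_inv, Real.norm_eq_abs, abs_of_pos hr]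
      rw [inv_mul_le_iff₀ hr]
      linarith [(hs a ha).2]
    · intro c hc e he hce
      obtain ⟨a, ha, rfl⟩ := Finset.mem_image.1 hc
      obtain ⟨b, hb, rfl⟩ := Finset.mem_image.1 he
      have hab : a ≠ b := fun h => hce (by rw [h])
      simp only [g, ← smul_sub, norm_smul, norm_inv, Real.norm_eq_abs, abs_of_pos hr,
        sub_sub_sub_cancel_right]
      rw [le_inv_mul_iff₀ hr]
      linarith [hsep a ha b hb hab]
  have h0 : P 0 := ⟨∅, by simp⟩
  obtain ⟨s, hcard, hs, hsep⟩ : P (Nat.findGreatest P (5 ^ d)) :=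
    Nat.findGreatest_spec (Nat.zero_le _) h0
  have hcover : closedBall x (2 * r) ∩ msupport μ ⊆ ⋃ c ∈ s, closedBall c r := by
    rintro y ⟨hy, hyS⟩
    by_contra hcon
    simp only [mem_iUnion, mem_closedBall, not_exists, not_le, dist_eq_norm] at hcon
    have hys : y ∉ s := fun h => by simpa using (hcon y h).trans' hr
    have : P (s.card + 1) := by
      refine ⟨insert y s, Finset.card_insert_of_notMem hys, ?_, ?_⟩
      · intro c hc
        rcases Finset.mem_insert.1 hc with rfl | hc
        · exact ⟨hyS, by simpa [dist_eq_norm] using hy⟩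
        · exact hs c hc
      · intro c hc e he hce
        rcases Finset.mem_insert.1 hc with h₁ | h₁ <;> rcases Finset.mem_insert.1 he with h₂ | h₂
        · exact absurd (h₁.trans h₂.symm) hce
        · exact h₁ ▸ (hcon e h₂).le
        · rw [norm_sub_rev]; exact h₂ ▸ (hcon c h₁).le
        · exact hsep c h₁ e h₂ hce
    have h2 := Nat.le_findGreatest (hbound _ this) this
    omega
  calc φ (2 * r) = μ (closedBall x (2 * r)) := (hφ.2.2 x hx _ (by positivity)).symm
    _ = μ (closedBall x (2 * r) ∩ msupport μ) :=
        (measure_inter_conull (ae_mem_msupport μ)).symm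
    _ ≤ μ (⋃ c ∈ s, closedBall c r) := measure_mono hcover
    _ ≤ ∑ c ∈ s, μ (closedBall c r) := measure_biUnion_finset_le _ _
    _ = ∑ c ∈ s, φ r := Finset.sum_congr rfl fun c hc => hφ.2.2 c (hs c hc).1 r hr
    _ = s.card * φ r := by simp
    _ ≤ 5 ^ d * φ r := by
        gcongr
        exact_mod_cast hbound _ ⟨s, rfl, hs, hsep⟩

theorem two_pow_mul_le (hφ : IsDistributionFunction μ φ) {r : ℝ} (hr : 0 < r) (k : ℕ) :
    φ (2 ^ k * r) ≤ (5 ^ d) ^ k * φ r := by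
  induction k with
  | zero => simp
  | succ k ih =>
    calc φ (2 ^ (k + 1) * r) = φ (2 * (2 ^ k * r)) := by ring_nf
      _ ≤ 5 ^ d * φ (2 ^ k * r) := hφ.two_mul_le (by positivity)
      _ ≤ 5 ^ d * ((5 ^ d) ^ k * φ r) := by gcongr
      _ = (5 ^ d) ^ (k + 1) * φ r := by ring

theorem toReal_pos (hφ : IsDistributionFunction μ φ) {r : ℝ} (hr : 0 < r) :
    0 < (φ r).toReal :=
  ENNReal.toReal_pos (hφ.2.1 r hr).1.ne' (hφ.2.1 r hr).2.ne

/-- The distribution function grows subexponentially, uniformly in the scale. -/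
theorem exists_mul_le (hφ : IsDistributionFunction μ φ) :
    ∃ K : ℝ, 0 < K ∧ ∀ l r : ℝ, 0 < l → 0 < r →
      φ (l * r) ≤ ENNReal.ofReal (K * Real.exp (l ^ 2 / 2)) * φ r := by
  set L : ℝ := Real.log (5 ^ d) with hL
  have hL0 : 0 ≤ L := Real.log_nonneg (one_le_pow₀ (by norm_num))
  refine ⟨Real.exp (L + L ^ 2 / 2), Real.exp_pos _, fun l r hl hr => ?_⟩
  set k := ⌈l⌉₊
  have hk : l ≤ 2 ^ k := (Nat.le_ceil l).trans (by exact_mod_cast (Nat.lt_two_pow_self).le)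
  have hk' : (k : ℝ) ≤ l + 1 := (Nat.ceil_lt_add_one hl.le).le
  calc φ (l * r) ≤ φ (2 ^ k * r) := hφ.mono (by positivity) (by gcongr)
    _ ≤ (5 ^ d) ^ k * φ r := hφ.two_pow_mul_le hr k
    _ = ENNReal.ofReal (Real.exp (L * k)) * φ r := by
        congr 1
        rw [mul_comm L, Real.exp_nat_mul, hL, Real.exp_log (by positivity),
          ENNReal.ofReal_pow (by positivity), ENNReal.ofReal_pow (by positivity)]
        norm_num
    _ ≤ _ := by
        gcongr
        rw [← Real.exp_add]
        apply Real.exp_le_exp.2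
        nlinarith [sq_nonneg (l - L)]

/-- Translating a measure does not change its distribution function. -/
theorem map_sub (hφ : IsDistributionFunction μ φ) (a : Euc d) :
    IsDistributionFunction (μ.map (fun z => z - a)) φ ∧
      ∀ x, x ∈ msupport μ → x - a ∈ msupport (μ.map (fun z => z - a)) := by
  have hball : ∀ x r, (μ.map (fun z => z - a)) (closedBall x r) = μ (closedBall (x + a) r) := by
    intro x r
    rw [Measure.map_apply (by fun_prop) measurableSet_closedBall]
    congr 1
    ext z
    simp [dist_eq_norm, sub_sub, add_comm]
  have hmem : ∀ x, x ∈ msupport μ → x - a ∈ msupport (μ.map (fun z => z - a)) := by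
    intro x hx r hr
    rw [hball]
    simpa using hx r hr
  refine ⟨⟨?_, hφ.2.1, ?_⟩, hmem⟩
  · obtain ⟨x, hx⟩ := hφ.1
    exact ⟨_, hmem x hx⟩
  · intro x hx r hr
    rw [hball]
    refine hφ.2.2 _ (fun t ht => ?_) r hr
    rw [← hball]
    exact hx t ht

theorem lintegral_gaussian_eq (hφ : IsDistributionFunction μ φ) {x : Euc d}
    (hx : x ∈ msupport μ) {s : ℝ} (hs : 0 < s) :
    ∫⁻ z, ENNReal.ofReal (Real.exp (-s * ‖z - x‖ ^ 2)) ∂μ =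
      ∫⁻ t in Ioo (0 : ℝ) 1, φ (√(-Real.log t) * (√s)⁻¹) := by
  rw [lintegral_eq_lintegral_meas_le μ (ae_of_all _ fun z => (Real.exp_pos _).le)
    (by fun_prop)]
  have hsplit : ∫⁻ t in Ioi (0 : ℝ), μ {a | t ≤ Real.exp (-s * ‖a - x‖ ^ 2)} =
      ∫⁻ t in Ioc (0 : ℝ) 1, μ {a | t ≤ Real.exp (-s * ‖a - x‖ ^ 2)} := by
    rw [← Ioc_union_Ioi_eq_Ioi (zero_le_one' ℝ), lintegral_union measurableSet_Ioi
      (by rw [disjoint_iff_inter_eq_empty]; ext t; simp)]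
    rw [setLIntegral_congr_fun (g := fun _ => 0) measurableSet_Ioi, lintegral_zero, add_zero]
    intro t ht
    simp only
    convert measure_empty (μ := μ)
    ext a
    simp only [mem_ofPred_eq, mem_empty_iff_false, iff_false, not_le]
    refine lt_of_le_of_lt ?_ (mem_Ioi.1 ht)
    rw [Real.exp_le_one_iff]
    nlinarith [sq_nonneg ‖a - x‖]
  rw [hsplit, setLIntegral_congr Ioo_ae_eq_Ioc.symm]
  refine setLIntegral_congr_fun measurableSet_Ioo fun t ht => ?_
  have hlog : 0 < -Real.log t := neg_pos.2 (Real.log_neg ht.1 ht.2)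
  have hr : 0 < √(-Real.log t) * (√s)⁻¹ := by positivity
  rw [← hφ.2.2 x hx _ hr]
  congr 1
  ext a
  rw [mem_ofPred_eq, mem_closedBall, dist_eq_norm, ← Real.log_le_iff_le_exp ht.1,
    ← div_eq_mul_inv, le_div_iff₀ (by positivity), Real.le_sqrt (by positivity) hlog.le, mul_pow,
    Real.sq_sqrt hs.le]
  constructor <;> intro h <;> linarith

theorem lintegral_gaussian_le (hφ : IsDistributionFunction μ φ) :
    ∃ C : ℝ, 0 < C ∧ ∀ x ∈ msupport μ, ∀ s : ℝ, 0 < s →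
      ∫⁻ z, ENNReal.ofReal (Real.exp (-s * ‖z - x‖ ^ 2)) ∂μ ≤ ENNReal.ofReal C * φ (√s)⁻¹ := by
  obtain ⟨K, hK, hle⟩ := hφ.exists_mul_le
  have h_integrable : IntegrableOn (fun t : ℝ => K * t ^ (-(1 / 2) : ℝ)) (Ioo 0 1) := by
    apply Integrable.const_mul
    have := (intervalIntegral.intervalIntegrable_rpow' (a := 0) (b := 1)
      (r := -(1/2)) (by norm_num)).1
    exact this.mono_set Ioo_subset_Ioc_self
  refine ⟨(∫ t in Ioo (0 : ℝ) 1, K * t ^ (-(1 / 2) : ℝ)) + 1, ?_, fun x hx s hs => ?_⟩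
  · have : 0 ≤ ∫ t in Ioo (0 : ℝ) 1, K * t ^ (-(1 / 2) : ℝ) :=
      setIntegral_nonneg measurableSet_Ioo fun t ht => by
        have := ht.1
        positivity
    linarith
  rw [hφ.lintegral_gaussian_eq hx hs]
  calc ∫⁻ t in Ioo (0 : ℝ) 1, φ (√(-Real.log t) * (√s)⁻¹)
      ≤ ∫⁻ t in Ioo (0 : ℝ) 1, ENNReal.ofReal (K * t ^ (-(1 / 2) : ℝ)) * φ (√s)⁻¹ := by
        refine setLIntegral_mono' measurableSet_Ioo fun t ht => ?_
        have hlog : 0 < -Real.log t := neg_pos.2 (Real.log_neg ht.1 ht.2)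
        refine (hle _ _ (Real.sqrt_pos.2 hlog) (by positivity)).trans (le_of_eq ?_)
        rw [Real.sq_sqrt hlog.le, Real.rpow_def_of_pos ht.1]
        congr 4
        ring
    _ = ENNReal.ofReal (∫ t in Ioo (0 : ℝ) 1, K * t ^ (-(1 / 2) : ℝ)) * φ (√s)⁻¹ := by
        rw [lintegral_mul_const'' _ h_integrable.aemeasurable.ennreal_ofReal,
          ofReal_integral_eq_lintegral_ofReal h_integrable]
        exact ae_restrict_of_forall_mem measurableSet_Ioo fun t ht => by
          have := ht.1
          positivity
    _ ≤ _ := by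
        gcongr
        linarith

theorem integrable_gaussian (hφ : IsDistributionFunction μ φ) {x : Euc d}
    (hx : x ∈ msupport μ) {s : ℝ} (hs : 0 < s) :
    Integrable (fun z => Real.exp (-s * ‖z - x‖ ^ 2)) μ := by
  obtain ⟨C, -, hC⟩ := hφ.lintegral_gaussian_le
  refine ⟨by fun_prop, ?_⟩
  rw [hasFiniteIntegral_iff_ofReal (ae_of_all _ fun z => (Real.exp_pos _).le)]
  exact (hC x hx s hs).trans_lt
    (ENNReal.mul_lt_top ENNReal.ofReal_lt_top (hφ.2.1 _ (by positivity)).2)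

theorem ofReal_integral_gaussian (hφ : IsDistributionFunction μ φ) {x : Euc d}
    (hx : x ∈ msupport μ) {s : ℝ} (hs : 0 < s) :
    ENNReal.ofReal (∫ z, Real.exp (-s * ‖z - x‖ ^ 2) ∂μ) =
      ∫⁻ t in Ioo (0 : ℝ) 1, φ (√(-Real.log t) * (√s)⁻¹) := by
  rw [ofReal_integral_eq_lintegral_ofReal (hφ.integrable_gaussian hx hs)
    (ae_of_all _ fun z => (Real.exp_pos _).le), hφ.lintegral_gaussian_eq hx hs]

theorem integral_gaussian_congr (hφ : IsDistributionFunction μ φ) {x y : Euc d}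
    (hx : x ∈ msupport μ) (hy : y ∈ msupport μ) {s : ℝ} (hs : 0 < s) :
    ∫ z, Real.exp (-s * ‖z - x‖ ^ 2) ∂μ = ∫ z, Real.exp (-s * ‖z - y‖ ^ 2) ∂μ := by
  rw [← ENNReal.ofReal_eq_ofReal_iff (integral_nonneg fun z => (Real.exp_pos _).le)
    (integral_nonneg fun z => (Real.exp_pos _).le), hφ.ofReal_integral_gaussian hx hs,
    hφ.ofReal_integral_gaussian hy hs]

theorem integral_gaussian_le (hφ : IsDistributionFunction μ φ) :
    ∃ C : ℝ, 0 < C ∧ ∀ x ∈ msupport μ, ∀ s : ℝ, 0 < s →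
      ∫ z, Real.exp (-s * ‖z - x‖ ^ 2) ∂μ ≤ C * (φ (√s)⁻¹).toReal := by
  obtain ⟨C, hC0, hC⟩ := hφ.lintegral_gaussian_le
  refine ⟨C, hC0, fun x hx s hs => ?_⟩
  have hfin := (hφ.2.1 (√s)⁻¹ (by positivity)).2.ne
  rw [← ENNReal.ofReal_le_ofReal_iff (by positivity), ENNReal.ofReal_mul hC0.le,
    ENNReal.ofReal_toReal hfin, hφ.ofReal_integral_gaussian hx hs,
    ← hφ.lintegral_gaussian_eq hx hs]
  exact hC x hx s hs

theorem integral_gaussian_quarter_le (hφ : IsDistributionFunction μ φ) {x : Euc d}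
    (hx : x ∈ msupport μ) {s : ℝ} (hs : 0 < s) :
    ∫ z, Real.exp (-(s / 4) * ‖z - x‖ ^ 2) ∂μ ≤
      5 ^ d * ∫ z, Real.exp (-s * ‖z - x‖ ^ 2) ∂μ := by
  have h0 : 0 ≤ ∫ z, Real.exp (-s * ‖z - x‖ ^ 2) ∂μ :=
    integral_nonneg fun z => (Real.exp_pos _).le
  rw [← ENNReal.ofReal_le_ofReal_iff (by positivity), ENNReal.ofReal_mul (by positivity),
    hφ.ofReal_integral_gaussian hx hs, hφ.ofReal_integral_gaussian hx (by positivity),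
    ← lintegral_const_mul' _ _ ENNReal.ofReal_ne_top]
  refine setLIntegral_mono' measurableSet_Ioo fun t ht => ?_
  have hlog : 0 < -Real.log t := neg_pos.2 (Real.log_neg ht.1 ht.2)
  have h4 : √(s / 4) = √s / 2 := by
    rw [Real.sqrt_div hs.le, show (4 : ℝ) = 2 ^ 2 by norm_num, Real.sqrt_sq (by norm_num)]
  have : √(-Real.log t) * (√(s / 4))⁻¹ = 2 * (√(-Real.log t) * (√s)⁻¹) := by
    rw [h4]
    field_simp
  rw [this, ENNReal.ofReal_pow (by norm_num)]
  norm_num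
  exact hφ.two_mul_le (by positivity)

theorem le_integral_gaussian (hφ : IsDistributionFunction μ φ) {x : Euc d}
    (hx : x ∈ msupport μ) {s r : ℝ} (hs : 0 < s) (hr : 0 < r) :
    Real.exp (-s * r ^ 2) * (φ r).toReal ≤ ∫ z, Real.exp (-s * ‖z - x‖ ^ 2) ∂μ := by
  have h_integrable := hφ.integrable_gaussian hx hs
  calc Real.exp (-s * r ^ 2) * (φ r).toReal
      = ∫ z in closedBall x r, Real.exp (-s * r ^ 2) ∂μ := by
        rw [setIntegral_const, measureReal_def, hφ.2.2 x hx r hr, smul_eq_mul, mul_comm]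
    _ ≤ ∫ z in closedBall x r, Real.exp (-s * ‖z - x‖ ^ 2) ∂μ := by
        refine setIntegral_mono_on ?_ h_integrable.integrableOn measurableSet_closedBall fun z hz => ?_
        · refine integrableOn_const ?_
          rw [hφ.2.2 x hx r hr]
          exact (hφ.2.1 r hr).2.ne
        · rw [mem_closedBall, dist_eq_norm] at hz
          have : ‖z - x‖ ^ 2 ≤ r ^ 2 := by gcongr
          exact Real.exp_le_exp.2 (by nlinarith)
    _ ≤ _ := setIntegral_le_integral h_integrable (ae_of_all _ fun z => (Real.exp_pos _).le)

theorem integral_gaussian_pos (hφ : IsDistributionFunction μ φ) {x : Euc d}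
    (hx : x ∈ msupport μ) {s : ℝ} (hs : 0 < s) :
    0 < ∫ z, Real.exp (-s * ‖z - x‖ ^ 2) ∂μ :=
  (mul_pos (Real.exp_pos _) (hφ.toReal_pos one_pos)).trans_le
    (hφ.le_integral_gaussian hx hs one_pos)

theorem integrable_exp_mul_gaussian (hφ : IsDistributionFunction μ φ)
    (h0 : (0 : Euc d) ∈ msupport μ) {s : ℝ} (hs : 0 < s) (a : ℝ) :
    Integrable (fun z => Real.exp (a * ‖z‖) * Real.exp (-s * ‖z‖ ^ 2)) μ := by
  have h := (hφ.integrable_gaussian h0 (half_pos hs)).const_mul (Real.exp (a ^ 2 / (2 * s)))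
  refine h.mono' (by fun_prop) (ae_of_all _ fun z => ?_)
  rw [Real.norm_of_nonneg (by positivity), ← Real.exp_add, ← Real.exp_add, sub_zero]
  apply Real.exp_le_exp.2
  have : a ^ 2 / (2 * s) - a * ‖z‖ + s / 2 * ‖z‖ ^ 2 = (a - s * ‖z‖) ^ 2 / (2 * s) := by
    field_simp
    ring
  have h2 : 0 ≤ (a - s * ‖z‖) ^ 2 / (2 * s) := by positivity
  linarith

theorem integrable_gaussian_sub (hφ : IsDistributionFunction μ φ)
    (h0 : (0 : Euc d) ∈ msupport μ) {s : ℝ} (hs : 0 < s) (x : Euc d) :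
    Integrable (fun z => Real.exp (-s * ‖z - x‖ ^ 2)) μ := by
  refine (hφ.integrable_exp_mul_gaussian h0 hs (2 * s * ‖x‖)).mono' (by fun_prop)
    (ae_of_all _ fun z => ?_)
  rw [Real.norm_of_nonneg (by positivity), ← Real.exp_add]
  apply Real.exp_le_exp.2
  rw [norm_sub_sq_real]
  have := real_inner_le_norm z x
  nlinarith [mul_le_mul_of_nonneg_left this hs.le, mul_nonneg hs.le (sq_nonneg ‖x‖)]

/-- The support is the common zero set of differences of Gaussian potentials. -/
theorem mem_msupport_of_integral_gaussian_eq (hφ : IsDistributionFunction μ φ)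
    (h0 : (0 : Euc d) ∈ msupport μ) {x : Euc d}
    (hx : ∀ s : ℝ, 1 ≤ s → ∫ z, Real.exp (-s * ‖z - x‖ ^ 2) ∂μ =
      ∫ z, Real.exp (-s * ‖z - 0‖ ^ 2) ∂μ) : x ∈ msupport μ := by
  by_contra hcon
  simp only [msupport, mem_ofPred_eq, not_forall, not_lt, nonpos_iff_eq_zero] at hcon
  obtain ⟨δ, hδ, hμ⟩ := hcon
  set A := ∫ z, Real.exp (-1 * ‖z - x‖ ^ 2) ∂μ
  have key : ∀ s : ℝ, 1 ≤ s →
      (φ (δ / 2)).toReal ≤ A * Real.exp (δ ^ 2) * Real.exp (-(3 / 4 * δ ^ 2 * s)) := by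
    intro s hs
    have h1 := hφ.le_integral_gaussian h0 (by linarith : 0 < s) (half_pos hδ)
    have h2 : ∫ z, Real.exp (-s * ‖z - x‖ ^ 2) ∂μ ≤ Real.exp (-(s - 1) * δ ^ 2) * A := by
      rw [← integral_const_mul]
      refine integral_mono_ae (hφ.integrable_gaussian_sub h0 (by linarith) x)
        ((hφ.integrable_gaussian_sub h0 one_pos x).const_mul _) ?_
      have : ∀ᵐ z ∂μ, z ∉ closedBall x δ := measure_eq_zero_iff_ae_notMem.1 hμ
      filter_upwards [this] with z hz
      rw [mem_closedBall, not_le, dist_eq_norm] at hz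
      rw [← Real.exp_add]
      apply Real.exp_le_exp.2
      have : δ ^ 2 ≤ ‖z - x‖ ^ 2 := by gcongr
      nlinarith
    rw [hx s hs] at h2
    have h3 := h1.trans h2
    have h4 : (φ (δ / 2)).toReal = Real.exp (s * (δ / 2) ^ 2) *
        (Real.exp (-s * (δ / 2) ^ 2) * (φ (δ / 2)).toReal) := by
      rw [← mul_assoc, ← Real.exp_add]
      simp
    rw [h4]
    refine (mul_le_mul_of_nonneg_left h3 (Real.exp_pos _).le).trans (le_of_eq ?_)
    rw [mul_comm _ A, mul_left_comm, mul_assoc, ← Real.exp_add, ← Real.exp_add]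
    congr 2
    ring
  have hlim : Tendsto (fun s : ℝ => A * Real.exp (δ ^ 2) * Real.exp (-(3 / 4 * δ ^ 2 * s)))
      atTop (nhds (A * Real.exp (δ ^ 2) * 0)) :=
    (Real.tendsto_exp_neg_atTop_nhds_zero.comp
      (tendsto_id.const_mul_atTop (by positivity : 0 < 3 / 4 * δ ^ 2))).const_mul _
  have := ge_of_tendsto hlim ((eventually_ge_atTop 1).mono key)
  rw [mul_zero] at this
  linarith [hφ.toReal_pos (half_pos hδ)]

end IsDistributionFunction

theorem integrable_norm_pow_mul {E : Type*} [NormedAddCommGroup E] [MeasurableSpace E]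
    [BorelSpace E] [SecondCountableTopology E] {μ : Measure E} {w : E → ℝ}
    (hw0 : ∀ z, 0 ≤ w z) (hwm : Measurable w)
    (hw : ∀ a : ℝ, Integrable (fun z => Real.exp (a * ‖z‖) * w z) μ) (n : ℕ) :
    Integrable (fun z => ‖z‖ ^ n * w z) μ := by
  refine ((hw 1).const_mul (n.factorial : ℝ)).mono' (by fun_prop) (ae_of_all _ fun z => ?_)
  rw [Real.norm_of_nonneg (mul_nonneg (by positivity) (hw0 z)), ← mul_assoc, one_mul]
  refine mul_le_mul_of_nonneg_right ?_ (hw0 z)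
  have := Real.pow_div_factorial_le_exp ‖z‖ (norm_nonneg z) n
  rwa [div_le_iff₀' (by positivity)] at this

section ExponentialIntegral

variable {E : Type*} [NormedAddCommGroup E] [InnerProductSpace ℝ E] [MeasurableSpace E]
  [BorelSpace E] [SecondCountableTopology E] {μ : Measure E} {w : E → ℝ}

theorem integrable_prod_inner_mul (hw0 : ∀ z, 0 ≤ w z) (hwm : Measurable w)
    (hw : ∀ a : ℝ, Integrable (fun z => Real.exp (a * ‖z‖) * w z) μ) {n : ℕ} (v : Fin n → E) :
    Integrable (fun z => (∏ i, inner ℝ (v i) z) * w z) μ := by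
  refine ((integrable_norm_pow_mul hw0 hwm hw n).const_mul (∏ i, ‖v i‖)).mono'
    (by fun_prop) (ae_of_all _ fun z => ?_)
  rw [norm_mul, Real.norm_of_nonneg (hw0 z), ← mul_assoc, norm_prod]
  refine mul_le_mul_of_nonneg_right ?_ (hw0 z)
  calc ∏ i, ‖inner ℝ (v i) z‖ ≤ ∏ i, (‖v i‖ * ‖z‖) :=
        Finset.prod_le_prod (fun _ _ => norm_nonneg _) fun i _ => norm_inner_le_norm _ _
    _ = _ := by simp [Finset.prod_mul_distrib]

/-- The Taylor coefficients of `x ↦ ∫ exp ⟪x, z⟫ w(z) dμ(z)` at the origin. -/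
def expIntegralSeries (hw0 : ∀ z, 0 ≤ w z) (hwm : Measurable w)
    (hw : ∀ a : ℝ, Integrable (fun z => Real.exp (a * ‖z‖) * w z) μ) :
    FormalMultilinearSeries ℝ E ℝ := fun n =>
  MultilinearMap.mkContinuous
    { toFun := fun v => (n.factorial : ℝ)⁻¹ * ∫ z, (∏ i, inner ℝ (v i) z) * w z ∂μ
      map_update_add' := by
        intro _ v i x y
        rw [← mul_add, ← integral_add (integrable_prod_inner_mul hw0 hwm hw _)
          (integrable_prod_inner_mul hw0 hwm hw _)]
        congr 2
        ext z
        rw [← add_mul, ← Finset.mul_prod_erase _ _ (Finset.mem_univ i),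
          ← Finset.mul_prod_erase _ _ (Finset.mem_univ i),
          ← Finset.mul_prod_erase _ _ (Finset.mem_univ i)]
        have h : ∀ u : E, ∏ j ∈ Finset.univ.erase i, inner ℝ (Function.update v i u j) z =
            ∏ j ∈ Finset.univ.erase i, inner ℝ (v j) z := fun u =>
          Finset.prod_congr rfl fun j hj => by
            rw [Function.update_of_ne (Finset.ne_of_mem_erase hj)]
        rw [h, h, h]
        simp only [Function.update_self, inner_add_left]
        ring
      map_update_smul' := by
        intro _ v i c x
        rw [smul_eq_mul, mul_left_comm]
        congr 1
        rw [← integral_const_mul]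
        congr 1
        ext z
        rw [← Finset.mul_prod_erase _ _ (Finset.mem_univ i),
          ← Finset.mul_prod_erase _ _ (Finset.mem_univ i)]
        have h : ∀ u : E, ∏ j ∈ Finset.univ.erase i, inner ℝ (Function.update v i u j) z =
            ∏ j ∈ Finset.univ.erase i, inner ℝ (v j) z := fun u =>
          Finset.prod_congr rfl fun j hj => by
            rw [Function.update_of_ne (Finset.ne_of_mem_erase hj)]
        rw [h, h]
        simp only [Function.update_self, inner_smul_left]
        simp only [conj_trivial]
        ring }
    ((n.factorial : ℝ)⁻¹ * ∫ z, ‖z‖ ^ n * w z ∂μ) (by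
      intro v
      simp only [MultilinearMap.coe_mk]
      rw [norm_mul, norm_inv, Real.norm_natCast, mul_assoc]
      refine mul_le_mul_of_nonneg_left ?_ (by positivity)
      rw [← integral_mul_const]
      refine norm_integral_le_of_norm_le
        ((integrable_norm_pow_mul hw0 hwm hw n).mul_const _) (ae_of_all _ fun z => ?_)
      rw [norm_mul, Real.norm_of_nonneg (hw0 z), mul_right_comm, norm_prod]
      refine mul_le_mul_of_nonneg_right ?_ (hw0 z)
      calc ∏ i, ‖inner ℝ (v i) z‖ ≤ ∏ i, (‖z‖ * ‖v i‖) :=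
            Finset.prod_le_prod (fun _ _ => norm_nonneg _) fun i _ => by
              rw [mul_comm]; exact norm_inner_le_norm _ _
        _ = _ := by simp [Finset.prod_mul_distrib])

theorem hasFPowerSeriesOnBall_expIntegral (hw0 : ∀ z, 0 ≤ w z) (hwm : Measurable w)
    (hw : ∀ a : ℝ, Integrable (fun z => Real.exp (a * ‖z‖) * w z) μ) :
    HasFPowerSeriesOnBall (fun x => ∫ z, Real.exp (inner ℝ x z) * w z ∂μ)
      (expIntegralSeries hw0 hwm hw) 0 ⊤ where
  r_le := by
    rw [FormalMultilinearSeries.radius_eq_top_of_summable_norm]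
    intro r
    have hle : ∀ n, ‖expIntegralSeries hw0 hwm hw n‖ * (r : ℝ) ^ n ≤
        ∫ z, (r * ‖z‖) ^ n / n.factorial * w z ∂μ := by
      intro n
      have h : ‖expIntegralSeries hw0 hwm hw n‖ ≤
          (n.factorial : ℝ)⁻¹ * ∫ z, ‖z‖ ^ n * w z ∂μ :=
        MultilinearMap.mkContinuous_norm_le _
          (mul_nonneg (by positivity)
            (integral_nonneg fun z => mul_nonneg (by positivity) (hw0 z))) _
      refine (mul_le_mul_of_nonneg_right h (by positivity)).trans (le_of_eq ?_)
      rw [mul_right_comm, ← integral_const_mul]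
      congr 1
      ext z
      rw [mul_pow]
      ring
    refine summable_of_sum_range_le (c := ∫ z, Real.exp (r * ‖z‖) * w z ∂μ)
      (fun n => by positivity) fun N => ?_
    refine (Finset.sum_le_sum fun n _ => hle n).trans ?_
    have h_integrable : ∀ n, Integrable (fun z => (r * ‖z‖) ^ n / n.factorial * w z) μ := fun n => by
      refine ((integrable_norm_pow_mul hw0 hwm hw n).const_mul
        ((r : ℝ) ^ n / n.factorial)).congr (ae_of_all _ fun z => ?_)
      simp only
      rw [mul_pow]
      ring
    rw [← integral_finsetSum _ fun n _ => h_integrable n]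
    refine integral_mono (integrable_finsetSum _ fun n _ => h_integrable n) (hw r) fun z => ?_
    simp only
    rw [← Finset.sum_mul]
    exact mul_le_mul_of_nonneg_right (Real.sum_le_exp_of_nonneg (by positivity) N) (hw0 z)
  r_pos := by simp
  hasSum := by
    intro y _
    have hF : ∀ n : ℕ, Integrable (fun z => inner ℝ y z ^ n / n.factorial * w z) μ := fun n => by
      refine ((integrable_prod_inner_mul hw0 hwm hw (fun _ : Fin n => y)).const_mul
        (n.factorial : ℝ)⁻¹).congr (ae_of_all _ fun z => ?_)
      simp only [Finset.prod_const, Finset.card_univ, Fintype.card_fin]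
      ring
    have hG : ∀ n : ℕ, Integrable (fun z => (‖y‖ * ‖z‖) ^ n / n.factorial * w z) μ := fun n => by
      refine ((integrable_norm_pow_mul hw0 hwm hw n).const_mul
        (‖y‖ ^ n / n.factorial)).congr (ae_of_all _ fun z => ?_)
      simp only
      rw [mul_pow]
      ring
    have hsum : Summable fun n : ℕ => ∫ z, ‖inner ℝ y z ^ n / n.factorial * w z‖ ∂μ := by
      refine summable_of_sum_range_le (c := ∫ z, Real.exp (‖y‖ * ‖z‖) * w z ∂μ)
        (fun n => by positivity) fun N => ?_
      rw [← integral_finsetSum _ fun n _ => (hF n).norm]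
      refine integral_mono (integrable_finsetSum _ fun n _ => (hF n).norm) (hw _) fun z => ?_
      simp only
      calc ∑ n ∈ Finset.range N, ‖inner ℝ y z ^ n / n.factorial * w z‖
          ≤ ∑ n ∈ Finset.range N, (‖y‖ * ‖z‖) ^ n / n.factorial * w z := by
            refine Finset.sum_le_sum fun n _ => ?_
            rw [norm_mul, norm_div, norm_pow, Real.norm_natCast, Real.norm_of_nonneg (hw0 z)]
            have := norm_inner_le_norm (𝕜 := ℝ) y z
            have := hw0 z
            gcongr
        _ ≤ _ := by
            rw [← Finset.sum_mul]
            exact mul_le_mul_of_nonneg_right (Real.sum_le_exp_of_nonneg (by positivity) N) (hw0 z)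
    have := hasSum_integral_of_summable_integral_norm hF hsum
    convert this using 1
    · ext n
      simp only [expIntegralSeries, MultilinearMap.coe_mkContinuous, MultilinearMap.coe_mk,
        Finset.prod_const, Finset.card_univ, Fintype.card_fin]
      rw [← integral_const_mul]
      congr 1
      ext z
      ring
    · congr 1
      ext z
      rw [tsum_mul_right, zero_add, Real.exp_eq_exp_ℝ, NormedSpace.exp_eq_tsum_div]

end ExponentialIntegral

theorem IsDistributionFunction.analyticAt_integral_gaussian {d : ℕ} {μ : Measure (Euc d)}
    {φ : ℝ → ENNReal} (hφ : IsDistributionFunction μ φ) (h0 : (0 : Euc d) ∈ msupport μ)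
    {s : ℝ} (hs : 0 < s) (x : Euc d) :
    AnalyticAt ℝ (fun x => ∫ z, Real.exp (-s * ‖z - x‖ ^ 2) ∂μ) x := by
  have hG := (hasFPowerSeriesOnBall_expIntegral (μ := μ)
    (w := fun z : Euc d => Real.exp (-s * ‖z‖ ^ 2)) (fun z => (Real.exp_pos _).le)
    (by fun_prop) (fun a => hφ.integrable_exp_mul_gaussian h0 hs a)).analyticOnNhd
  have h1 : AnalyticAt ℝ (fun x : Euc d => (2 * s) • x) x := by fun_prop
  have h2 := (hG ((2 * s) • x) (by simp)).comp h1
  have h3 : AnalyticAt ℝ (fun x : Euc d => Real.exp (-s * ‖x‖ ^ 2)) x :=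
    (analyticAt_rexp.comp ((analyticAt_const (v := -s)).mul
      (contDiff_norm_sq ℝ (n := ⊤)).contDiffAt.analyticAt))
  refine (h3.mul h2).congr (Eventually.of_forall fun y => ?_)
  simp only [Function.comp, Pi.mul_apply]
  rw [← integral_const_mul]
  congr 1
  ext z
  rw [← Real.exp_add, ← Real.exp_add, norm_sub_sq_real, inner_smul_left, real_inner_comm]
  simp only [conj_trivial]
  congr 1
  ring

/-- A function which is eventually constant up to every multiplicative error converges to a
positive limit. -/
theorem exists_tendsto_pos_of_ratio {α : Type*} {l : Filter α} [l.NeBot] {q : α → ℝ}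
    (h : ∀ η : ℝ, 1 < η → ∃ a : ℝ, 0 < a ∧ ∀ᶠ r in l, a ≤ q r ∧ q r ≤ η * a) :
    ∃ c : ℝ, 0 < c ∧ Tendsto q l (nhds c) := by
  obtain ⟨a₀, ha₀, h₀⟩ := h 2 one_lt_two
  have hc : Cauchy (map q l) := by
    refine Metric.cauchy_iff.2 ⟨inferInstance, fun ε hε => ?_⟩
    obtain ⟨a, ha, h1⟩ := h (1 + ε / (4 * a₀)) (by simp; positivity)
    refine ⟨Icc a ((1 + ε / (4 * a₀)) * a), h1, fun x hx y hy => ?_⟩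
    obtain ⟨r, hr⟩ := (h1.and h₀).exists
    have : a ≤ 2 * a₀ := hr.1.1.trans hr.2.2
    have h3 : ε / (4 * a₀) * a ≤ ε / 2 := by
      calc ε / (4 * a₀) * a ≤ ε / (4 * a₀) * (2 * a₀) := by gcongr
        _ = ε / 2 := by field_simp; norm_num
    have h4 := Real.dist_le_of_mem_Icc hx hy
    linarith
  obtain ⟨c, hc⟩ := CompleteSpace.complete hc
  refine ⟨c, ?_, hc⟩
  exact ha₀.trans_le (ge_of_tendsto (show Tendsto q l (nhds c) from hc) (h₀.mono fun r hr => hr.1))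

theorem eventually_measure_closedBall_le {E : Type*} [NormedAddCommGroup E]
    [MeasurableSpace E] [BorelSpace E] [NormedSpace ℝ E] [ProperSpace E] (μ : Measure E)
    [IsFiniteMeasureOnCompacts μ] (x : E) {ρ : ℝ} (hρ : 0 < ρ) {η : ℝ} (hη : 1 < η)
    (hpos : 0 < μ (closedBall x ρ)) :
    ∀ᶠ r in nhdsWithin 0 (Ioi 0),
      μ.real (closedBall x (ρ + r)) ≤ η * μ.real (closedBall x ρ) := by
  have h1 : Tendsto (fun r => μ (cthickening r (closedBall x ρ))) (nhds 0)
      (nhds (μ (closedBall x ρ))) := by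
    refine tendsto_measure_cthickening_of_isClosed ⟨1, one_pos, ?_⟩ isClosed_closedBall
    exact ((isCompact_closedBall x ρ).cthickening).measure_lt_top.ne
  have hfin : μ (closedBall x ρ) ≠ ⊤ := (isCompact_closedBall x ρ).measure_lt_top.ne
  have h2 := ((ENNReal.tendsto_toReal hfin).comp h1).mono_left
    (nhdsWithin_le_nhds (s := Ioi 0))
  have hpos' : 0 < (μ (closedBall x ρ)).toReal := ENNReal.toReal_pos hpos.ne' hfin
  filter_upwards [h2.eventually_le_const
    (show (μ (closedBall x ρ)).toReal < η * (μ (closedBall x ρ)).toReal by nlinarith),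
    self_mem_nhdsWithin] with r hr hr0
  simp only [Function.comp] at hr
  rwa [cthickening_closedBall (mem_Ioi.1 hr0).le hρ.le, add_comm] at hr

section

variable {E : Type*} [NormedAddCommGroup E] [MeasurableSpace E] [BorelSpace E]
  [SecondCountableTopology E]

theorem lintegral_measure_closedBall_inter (μ ν : Measure E) [SFinite μ] [SFinite ν]
    {A B : Set E} (_hA : MeasurableSet A) (_hB : MeasurableSet B) (r : ℝ) :
    ∫⁻ y in A, μ (closedBall y r ∩ B) ∂ν = ∫⁻ x in B, ν (closedBall x r ∩ A) ∂μ := by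
  have hs : MeasurableSet {p : E × E | dist p.1 p.2 ≤ r} :=
    measurableSet_le (by fun_prop) measurable_const
  have h1 := Measure.prod_apply (μ := μ.restrict B) (ν := ν.restrict A) hs
  have h2 := Measure.prod_apply_symm (μ := μ.restrict B) (ν := ν.restrict A) hs
  rw [h1] at h2
  convert h2.symm using 1
  · refine lintegral_congr fun y => ?_
    rw [Measure.restrict_apply (by measurability)]
    rfl
  · refine lintegral_congr fun x => ?_
    rw [Measure.restrict_apply (hs.preimage measurable_prodMk_left)]
    congr 2
    ext y
    simp [dist_comm]

theorem mul_measure_closedBall_le (μ ν : Measure E) [SFinite μ] [SFinite ν] {x₀ : E}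
    {ρ r : ℝ} {a b : ENNReal} (ha : ∀ᵐ y ∂ν, y ∈ closedBall x₀ ρ → a ≤ μ (closedBall y r))
    (hb : ∀ᵐ x ∂μ, x ∈ closedBall x₀ (ρ + r) → ν (closedBall x r) ≤ b) :
    a * ν (closedBall x₀ ρ) ≤ b * μ (closedBall x₀ (ρ + r)) := by
  calc a * ν (closedBall x₀ ρ) = ∫⁻ y in closedBall x₀ ρ, a ∂ν := by simp
    _ ≤ ∫⁻ y in closedBall x₀ ρ, μ (closedBall y r ∩ closedBall x₀ (ρ + r)) ∂ν := by
        refine lintegral_mono_ae ?_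
        rw [ae_restrict_iff' measurableSet_closedBall]
        filter_upwards [ha] with y hy hyK
        have hsub : closedBall y r ⊆ closedBall x₀ (ρ + r) :=
          closedBall_subset_closedBall' (by rw [mem_closedBall] at hyK; linarith)
        rw [inter_eq_left.2 hsub]
        exact hy hyK
    _ = ∫⁻ x in closedBall x₀ (ρ + r), ν (closedBall x r ∩ closedBall x₀ ρ) ∂μ :=
        lintegral_measure_closedBall_inter μ ν measurableSet_closedBall measurableSet_closedBall r
    _ ≤ ∫⁻ x in closedBall x₀ (ρ + r), b ∂μ := by
        refine lintegral_mono_ae ?_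
        rw [ae_restrict_iff' measurableSet_closedBall]
        filter_upwards [hb] with x hx hxK
        exact (measure_mono inter_subset_left).trans (hx hxK)
    _ = _ := by simp

end

section Chart

variable {d : ℕ} {μ : Measure (Euc d)} [IsLocallyFiniteMeasure μ] {φ : ℝ → ENNReal}
  {T : Type*} [NormedAddCommGroup T] [InnerProductSpace ℝ T] [FiniteDimensional ℝ T]
  [MeasurableSpace T] [BorelSpace T]

/-- If the support is parametrised near one of its points by an almost isometric chart defined
on an `n`-dimensional space, then the distribution function is asymptotic to a multiple
of `r ^ n`. -/
theorem IsDistributionFunction.hasDim0_of_chart (hφ : IsDistributionFunction μ φ) {g : T → Euc d}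
    (hmem : ∀ᶠ t in nhds 0, g t ∈ msupport μ)
    (hiso : ∀ ε : ℝ, 0 < ε → ∃ δ : ℝ, 0 < δ ∧ ∀ a ∈ ball (0 : T) δ, ∀ b ∈ ball (0 : T) δ,
      (1 - ε) * ‖a - b‖ ≤ ‖g a - g b‖ ∧ ‖g a - g b‖ ≤ (1 + ε) * ‖a - b‖)
    (hsurj : ∀ W ∈ nhds (0 : T), ∀ᶠ y in nhds (g 0), y ∈ msupport μ → y ∈ g '' W) :
    HasDim0 φ (Module.finrank ℝ T) := by
  set n := Module.finrank ℝ T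
  set ω : ENNReal := volume (ball (0 : T) 1)
  have hω0 : 0 < ω := measure_ball_pos _ _ one_pos
  have hωt : ω ≠ ⊤ := measure_ball_lt_top.ne
  have hωr : 0 < ω.toReal := ENNReal.toReal_pos hω0.ne' hωt
  apply exists_tendsto_pos_of_ratio
  intro η hη
  obtain ⟨ε, hε0, hε1, hεη⟩ : ∃ ε : ℝ, 0 < ε ∧ ε < 1 ∧
      (1 + ε) ^ (n + 2) / (1 - ε) ^ n ≤ η := by
    have hcont : ContinuousAt (fun ε : ℝ => (1 + ε) ^ (n + 2) / (1 - ε) ^ n) 0 := by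
      refine ContinuousAt.div (by fun_prop) (by fun_prop) (by simp)
    have h1 : ∀ᶠ ε in nhdsWithin (0 : ℝ) (Ioi 0), (1 + ε) ^ (n + 2) / (1 - ε) ^ n ≤ η :=
      (hcont.mono_left nhdsWithin_le_nhds).eventually_le_const (by simpa using hη)
    obtain ⟨ε, h1, h2⟩ := (h1.and (Ioo_mem_nhdsGT one_pos)).exists
    exact ⟨ε, h2.1, h2.2, h1⟩
  obtain ⟨δ₁, hδ₁, hg₁⟩ := hiso ε hε0
  obtain ⟨δ₂, hδ₂, hg₂⟩ := Metric.eventually_nhds_iff_ball.1 hmem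
  set δ := min δ₁ δ₂
  have hδ : 0 < δ := lt_min hδ₁ hδ₂
  have hlow : ∀ a ∈ ball (0 : T) δ, ∀ b ∈ ball (0 : T) δ, (1 - ε) * ‖a - b‖ ≤ ‖g a - g b‖ :=
    fun a ha b hb => (hg₁ a (ball_subset_ball (min_le_left _ _) ha) b
      (ball_subset_ball (min_le_left _ _) hb)).1
  have hupp : ∀ a ∈ ball (0 : T) δ, ∀ b ∈ ball (0 : T) δ, ‖g a - g b‖ ≤ (1 + ε) * ‖a - b‖ :=
    fun a ha b hb => (hg₁ a (ball_subset_ball (min_le_left _ _) ha) b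
      (ball_subset_ball (min_le_left _ _) hb)).2
  have hgS : ∀ t ∈ ball (0 : T) δ, g t ∈ msupport μ :=
    fun t ht => hg₂ t (ball_subset_ball (min_le_right _ _) ht)
  have h0δ : (0 : T) ∈ ball (0 : T) δ := mem_ball_self hδ
  have hgcont : ContinuousOn g (ball 0 δ) := by
    have : LipschitzOnWith (Real.toNNReal (1 + ε)) g (ball 0 δ) :=
      LipschitzOnWith.of_dist_le_mul fun a ha b hb => by
        rw [dist_eq_norm, dist_eq_norm, Real.coe_toNNReal _ (by positivity)]
        exact hupp a ha b hb
    exact this.continuousOn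
  have hgm : AEMeasurable g (volume.restrict (ball 0 δ)) := hgcont.aemeasurable measurableSet_ball
  set ν : Measure (Euc d) := (volume.restrict (ball 0 δ)).map g with hν
  have hfin : IsFiniteMeasure (volume.restrict (ball (0 : T) δ)) :=
    ⟨by rw [Measure.restrict_apply_univ]; exact measure_ball_lt_top⟩
  have hνball : ∀ x r, ν (closedBall x r) = volume (g ⁻¹' closedBall x r ∩ ball 0 δ) := by
    intro x r
    rw [hν, Measure.map_apply_of_aemeasurable hgm measurableSet_closedBall,
      Measure.restrict_apply' measurableSet_ball]
  have hνS : ∀ᵐ y ∂ν, y ∈ msupport μ := by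
    refine (ae_map_iff (p := fun y => y ∈ msupport μ) hgm (isClosed_msupport μ).measurableSet).2 ?_
    exact ae_restrict_of_forall_mem measurableSet_ball hgS
  have hvol : ∀ (t : T) (r : ℝ), 0 < r →
      volume (closedBall t r) = ENNReal.ofReal (r ^ n) * ω := fun t r hr =>
    Measure.addHaar_closedBall _ _ hr.le
  obtain ⟨δ', hδ', hsurj'⟩ := Metric.eventually_nhds_iff_ball.1
    (hsurj (ball 0 (δ / 2)) (ball_mem_nhds _ (half_pos hδ)))
  set ρ := δ' / 2
  have hρ : 0 < ρ := half_pos hδ'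
  have hparam : ∀ r, r < ρ → ∀ x ∈ msupport μ, x ∈ closedBall (g 0) (ρ + r) →
      ∃ t ∈ ball (0 : T) (δ / 2), g t = x := by
    intro r hr x hx hxK
    refine hsurj' x (closedBall_subset_ball ?_ hxK) hx
    have h2 : ρ + ρ = δ' := add_halves δ'
    linarith
  have h1ε : 0 < 1 - ε := by linarith
  have hup : ∀ r, 0 < r → r < ρ → ∀ x ∈ msupport μ, x ∈ closedBall (g 0) (ρ + r) →
      ν (closedBall x r) ≤ ENNReal.ofReal ((r / (1 - ε)) ^ n) * ω := by
    intro r hr0 hr x hx hxK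
    obtain ⟨t, ht, rfl⟩ := hparam r hr x hx hxK
    have ht' := ball_subset_ball (half_le_self hδ.le) ht
    rw [hνball, ← hvol t _ (by positivity)]
    refine measure_mono fun a ha => ?_
    have h1 := hlow a ha.2 t ht'
    have h2 := ha.1
    rw [mem_preimage, mem_closedBall, dist_eq_norm] at h2
    rw [mem_closedBall, dist_eq_norm, le_div_iff₀ h1ε]
    linarith
  have hdown : ∀ r, 0 < r → r < ρ → r < δ / 2 → ∀ x ∈ msupport μ,
      x ∈ closedBall (g 0) (ρ + r) →
      ENNReal.ofReal ((r / (1 + ε)) ^ n) * ω ≤ ν (closedBall x r) := by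
    intro r hr0 hr hrδ x hx hxK
    obtain ⟨t, ht, rfl⟩ := hparam r hr x hx hxK
    have ht' := ball_subset_ball (half_le_self hδ.le) ht
    rw [hνball, ← hvol t _ (by positivity)]
    refine measure_mono fun a ha => ?_
    rw [mem_closedBall, dist_eq_norm] at ha
    have ha' : a ∈ ball (0 : T) δ := by
      rw [mem_ball_zero_iff] at ht ⊢
      have : r / (1 + ε) ≤ r := div_le_self hr0.le (by linarith)
      have := norm_le_norm_add_norm_sub' a t
      linarith
    refine ⟨?_, ha'⟩
    rw [mem_preimage, mem_closedBall, dist_eq_norm]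
    refine (hupp a ha' t ht').trans ?_
    rw [le_div_iff₀ (by positivity)] at ha
    linarith
  have hmpos : 0 < μ (closedBall (g 0) ρ) := hgS 0 h0δ ρ hρ
  have hvpos : 0 < ν (closedBall (g 0) ρ) := by
    set r := min (ρ / 2) (δ / 4)
    have hr0 : 0 < r := lt_min (by positivity) (by positivity)
    have hr1 : r < ρ := (min_le_left _ _).trans_lt (half_lt_self hρ)
    have hr2 : r < δ / 2 := (min_le_right _ _).trans_lt (by linarith)
    refine lt_of_lt_of_le ?_ ((hdown r hr0 hr1 hr2 (g 0) (hgS 0 h0δ)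
      (mem_closedBall_self (by positivity))).trans
        (measure_mono (closedBall_subset_closedBall hr1.le)))
    exact ENNReal.mul_pos (by positivity) hω0.ne'
  have hmfin : ∀ R, μ (closedBall (g 0) R) ≠ ⊤ := fun R =>
    (isCompact_closedBall _ _).measure_lt_top.ne
  have hvfin : ∀ R, ν (closedBall (g 0) R) ≠ ⊤ := fun R => measure_ne_top _ _
  set m := μ.real (closedBall (g 0) ρ)
  set v := ν.real (closedBall (g 0) ρ)
  have hm : 0 < m := ENNReal.toReal_pos hmpos.ne' (hmfin ρ)
  have hv : 0 < v := ENNReal.toReal_pos hvpos.ne' (hvfin ρ)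
  refine ⟨ω.toReal * m / ((1 + ε) ^ (n + 1) * v), by positivity, ?_⟩
  filter_upwards [eventually_measure_closedBall_le μ (g 0) hρ (by linarith : 1 < 1 + ε) hmpos,
    eventually_measure_closedBall_le ν (g 0) hρ (by linarith : 1 < 1 + ε) hvpos,
    Ioo_mem_nhdsGT hρ, Ioo_mem_nhdsGT (half_pos hδ)] with r hr1 hr2 hr3 hr4
  have hr0 : 0 < r := hr3.1
  have hφt : φ r ≠ ⊤ := (hφ.2.1 r hr0).2.ne
  have hA := mul_measure_closedBall_le μ ν (x₀ := g 0) (ρ := ρ) (r := r) (a := φ r)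
    (b := ENNReal.ofReal ((r / (1 - ε)) ^ n) * ω)
    (by filter_upwards [hνS] with y hy _ using (hφ.2.2 y hy r hr0).ge)
    (by filter_upwards [ae_mem_msupport μ] with x hx hxK using hup r hr0 hr3.2 x hx hxK)
  have hB := mul_measure_closedBall_le ν μ (x₀ := g 0) (ρ := ρ) (r := r)
    (a := ENNReal.ofReal ((r / (1 + ε)) ^ n) * ω) (b := φ r)
    (by
      filter_upwards [ae_mem_msupport μ] with x hx hxK
      exact hdown r hr0 hr3.2 hr4.2 x hx (closedBall_subset_closedBall (by linarith) hxK))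
    (by filter_upwards [hνS] with y hy _ using (hφ.2.2 y hy r hr0).le)
  have hA' := ENNReal.toReal_mono
    (ENNReal.mul_ne_top (ENNReal.mul_ne_top ENNReal.ofReal_ne_top hωt) (hmfin _)) hA
  have hB' := ENNReal.toReal_mono (ENNReal.mul_ne_top hφt (hvfin _)) hB
  simp only [ENNReal.toReal_mul] at hA' hB'
  rw [ENNReal.toReal_ofReal (by positivity)] at hA' hB'
  simp only [← measureReal_def] at hA' hB'
  set q := (φ r).toReal
  have hq : 0 < q := hφ.toReal_pos hr0
  have hA2 : q * v ≤ (r / (1 - ε)) ^ n * ω.toReal * ((1 + ε) * m) :=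
    hA'.trans (by gcongr)
  have hB2 : (r / (1 + ε)) ^ n * ω.toReal * m ≤ q * ((1 + ε) * v) :=
    hB'.trans (by gcongr)
  rw [div_pow] at hA2 hB2
  constructor
  · rw [div_le_div_iff₀ (by positivity) (by positivity)]
    have : r ^ n / (1 + ε) ^ n * ω.toReal * m * (1 + ε) ^ n ≤
        q * ((1 + ε) * v) * (1 + ε) ^ n := by gcongr
    have h3 : r ^ n / (1 + ε) ^ n * ω.toReal * m * (1 + ε) ^ n = r ^ n * ω.toReal * m := by
      field_simp
    rw [h3] at this
    rw [pow_succ]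
    linarith
  · have h3 : q / r ^ n ≤ (1 + ε) ^ (n + 2) / (1 - ε) ^ n *
        (ω.toReal * m / ((1 + ε) ^ (n + 1) * v)) := by
      rw [div_le_iff₀ (by positivity)]
      have h4 : q ≤ r ^ n / (1 - ε) ^ n * ω.toReal * ((1 + ε) * m) / v := by
        rwa [le_div_iff₀ hv]
      refine h4.trans (le_of_eq ?_)
      field_simp
      ring
    exact h3.trans (by gcongr)

end Chart

section Conormal

variable {E : Type*} [NormedAddCommGroup E] [InnerProductSpace ℝ E]

/-- The gradients at `x` of the real analytic functions vanishing on `S` near `x`. -/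
def conormal (S : Set E) (x : E) : Submodule ℝ E where
  carrier := {v | ∃ f : E → ℝ, AnalyticAt ℝ f x ∧ (∀ᶠ y in nhds x, y ∈ S → f y = 0) ∧
    HasFDerivAt f (innerSL ℝ v) x}
  add_mem' := by
    rintro v w ⟨f, hf, hfS, hf'⟩ ⟨g, hg, hgS, hg'⟩
    refine ⟨f + g, hf.add hg, ?_, ?_⟩
    · filter_upwards [hfS, hgS] with y h1 h2 hy
      simp [h1 hy, h2 hy]
    · rw [map_add]
      exact hf'.add hg'
  zero_mem' := ⟨fun _ => 0, analyticAt_const, by simp, by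
    rw [map_zero]; exact hasFDerivAt_const _ _⟩
  smul_mem' := by
    rintro c v ⟨f, hf, hfS, hf'⟩
    refine ⟨c • f, hf.const_smul, ?_, ?_⟩
    · filter_upwards [hfS] with y h1 hy
      simp [h1 hy]
    · rw [map_smul]
      exact hf'.const_smul c

theorem exists_analyticAt_hasFDerivAt_orthogonalProjectionOnto [FiniteDimensional ℝ E]
    (S : Set E) (x : E) :
    ∃ f : E → conormal S x, AnalyticAt ℝ f x ∧ (∀ᶠ y in nhds x, y ∈ S → f y = 0) ∧
      HasFDerivAt f (conormal S x).orthogonalProjectionOnto x := by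
  set b := stdOrthonormalBasis ℝ (conormal S x)
  have hb : ∀ i, (b i : E) ∈ conormal S x := fun i => (b i).2
  choose f hf hfS hf' using hb
  refine ⟨fun y => ∑ i, f i y • b i, ?_, ?_, ?_⟩
  · exact Finset.analyticAt_fun_sum _ fun i _ => (hf i).smul analyticAt_const
  · filter_upwards [eventually_all.2 hfS] with y h hy
    simp [h _ hy]
  · have h1 : HasFDerivAt (fun y => ∑ i, f i y • b i)
        (∑ i, (innerSL ℝ (b i : E)).smulRight (b i)) x :=
      HasFDerivAt.fun_sum fun i _ => (hf' i).smul_const (b i)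
    convert h1 using 1
    ext1 y
    rw [b.orthogonalProjectionOnto_apply_eq_sum]
    simp

theorem AnalyticAt.exists_local_inverse_of_hasFDerivAt_id [CompleteSpace E] {Ψ : E → E} {x : E}
    (hΨ : AnalyticAt ℝ Ψ x) (h : HasFDerivAt Ψ (ContinuousLinearMap.id ℝ E) x) :
    ∃ g : E → E, AnalyticAt ℝ g (Ψ x) ∧ g (Ψ x) = x ∧
      HasFDerivAt g (ContinuousLinearMap.id ℝ E) (Ψ x) ∧
      (∀ᶠ y in nhds (Ψ x), Ψ (g y) = y) ∧ ∀ᶠ y in nhds x, g (Ψ y) = y := by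
  have hs : HasStrictFDerivAt Ψ ((ContinuousLinearEquiv.refl ℝ E : E ≃L[ℝ] E) : E →L[ℝ] E) x := by
    have := hΨ.hasStrictFDerivAt
    rw [h.fderiv] at this
    exact this
  refine ⟨hs.localInverse, ?_, hs.localInverse_apply_image, hs.to_localInverse.hasFDerivAt,
    hs.eventually_right_inverse, hs.eventually_left_inverse⟩
  exact (hs.toOpenPartialHomeomorph Ψ).analyticAt_symm'
    (i := ContinuousLinearEquiv.refl ℝ E) hs.mem_toOpenPartialHomeomorph_source hΨ
    (by rw [hs.toOpenPartialHomeomorph_coe]; exact h.fderiv)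

theorem fderiv_apply_eq_zero_of_finrank_conormal_le [FiniteDimensional ℝ E] {S : Set E} {x : E}
    {V : Submodule ℝ E} {f : E → V} (hf : AnalyticAt ℝ f x)
    (hfS : ∀ᶠ y in nhds x, y ∈ S → f y = 0) {G : E →L[ℝ] E}
    (hG : (fderiv ℝ f x).comp G = V.orthogonalProjectionOnto)
    (hV : Module.finrank ℝ (conormal S x) ≤ Module.finrank ℝ V)
    {h : E → ℝ} (hh : AnalyticAt ℝ h x) (hhS : ∀ᶠ y in nhds x, y ∈ S → h y = 0)
    {u : E} (hu : u ∈ Vᗮ) : fderiv ℝ h x (G u) = 0 := by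
  set A : V →ₗ[ℝ] E := (ContinuousLinearMap.adjoint (fderiv ℝ f x)).toLinearMap
  have hA : ∀ (v : V) (y : E), inner ℝ (A v) y = inner ℝ v (fderiv ℝ f x y) := fun v y =>
    ContinuousLinearMap.adjoint_inner_left _ _ _
  have hGP : ∀ y, fderiv ℝ f x (G y) = V.orthogonalProjectionOnto y := fun y =>
    congrArg (fun L : E →L[ℝ] V => L y) hG
  have hinj : Function.Injective A := by
    rw [injective_iff_map_eq_zero]
    intro v hv
    have h1 := hA v (G v)
    rw [hv, hGP, inner_zero_left, Submodule.orthogonalProjectionOnto_mem_subspace_eq_self] at h1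
    exact inner_self_eq_zero.1 h1.symm
  have hle : LinearMap.range A ≤ conormal S x := by
    rintro _ ⟨v, rfl⟩
    refine ⟨fun y => inner ℝ v (f y), ?_, ?_, ?_⟩
    · exact ((innerSL ℝ v).analyticAt _).comp hf
    · filter_upwards [hfS] with y h1 hy
      simp [h1 hy]
    · have h2 := ((innerSL ℝ v).hasFDerivAt (x := f x)).comp x hf.differentiableAt.hasFDerivAt
      have h3 : innerSL ℝ (A v) = (innerSL ℝ v).comp (fderiv ℝ f x) := by
        ext y
        exact hA v y
      rw [h3]
      exact h2
  have heq : LinearMap.range A = conormal S x := by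
    refine Submodule.eq_of_le_of_finrank_le hle ?_
    rwa [LinearMap.finrank_range_of_inj hinj]
  have hmem : (InnerProductSpace.toDual ℝ E).symm (fderiv ℝ h x) ∈ conormal S x := by
    refine ⟨h, hh, hhS, ?_⟩
    have h3 : innerSL ℝ ((InnerProductSpace.toDual ℝ E).symm (fderiv ℝ h x)) = fderiv ℝ h x := by
      ext y
      exact InnerProductSpace.toDual_symm_apply
    rw [h3]
    exact hh.differentiableAt.hasFDerivAt
  rw [← heq] at hmem
  obtain ⟨v, hv⟩ := hmem
  have h3 := hA v (G u)
  rw [hv, InnerProductSpace.toDual_symm_apply, hGP] at h3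
  rw [h3, Submodule.orthogonalProjectionOnto_eq_zero_iff.2 hu, inner_zero_right]

theorem exists_straightening [FiniteDimensional ℝ E] {S : Set E} {x₀ : E} (hx₀ : x₀ ∈ S)
    (hmax : ∀ x ∈ S, Module.finrank ℝ (conormal S x) ≤ Module.finrank ℝ (conormal S x₀)) :
    ∃ (T : Submodule ℝ E) (g : E → E) (π : E → T) (r : ℝ), 0 < r ∧ g 0 = x₀ ∧
      AnalyticOnNhd ℝ g (ball 0 r) ∧ HasFDerivAt g (ContinuousLinearMap.id ℝ E) 0 ∧
      ∀ t : T, (t : E) ∈ ball (0 : E) r → g t ∈ S →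
        AnalyticAt ℝ π (g t) ∧ (∀ᶠ y in nhds (t : E), π (g y) = T.orthogonalProjectionOnto y) ∧
        (∀ᶠ x in nhds (g t), x ∈ S → g (π x) = x) ∧
        ∀ h : E → ℝ, AnalyticAt ℝ h (g t) → (∀ᶠ x in nhds (g t), x ∈ S → h x = 0) →
          ∀ u ∈ T, fderiv ℝ h (g t) (fderiv ℝ g t u) = 0 := by
  set V := conormal S x₀
  obtain ⟨f, hf, hfS, hf'⟩ : ∃ f : E → V, AnalyticAt ℝ f x₀ ∧
      (∀ᶠ y in nhds x₀, y ∈ S → f y = 0) ∧ HasFDerivAt f V.orthogonalProjectionOnto x₀ :=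
    exists_analyticAt_hasFDerivAt_orthogonalProjectionOnto S x₀
  set Ψ : E → E := fun x => (Vᗮ.orthogonalProjectionOnto (x - x₀) : E) + f x with hΨdef
  have hπan : ∀ x, AnalyticAt ℝ (fun x => Vᗮ.orthogonalProjectionOnto (x - x₀)) x := fun x =>
    (Vᗮ.orthogonalProjectionOnto.analyticAt _).comp (analyticAt_id.sub analyticAt_const)
  have hΨan : ∀ x, AnalyticAt ℝ f x → AnalyticAt ℝ Ψ x := fun x hx =>
    ((Vᗮ.subtypeL.analyticAt _).comp (hπan x)).add ((V.subtypeL.analyticAt _).comp hx)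
  have hΨx₀ : Ψ x₀ = 0 := by simp [hΨdef, hfS.self_of_nhds hx₀]
  have hΨ' : HasFDerivAt Ψ (ContinuousLinearMap.id ℝ E) x₀ := by
    have h1 : HasFDerivAt Ψ (Vᗮ.subtypeL.comp (Vᗮ.orthogonalProjectionOnto.comp
        (ContinuousLinearMap.id ℝ E)) + V.subtypeL.comp V.orthogonalProjectionOnto) x₀ := by
      refine HasFDerivAt.add ?_ (V.subtypeL.hasFDerivAt.comp x₀ hf')
      refine Vᗮ.subtypeL.hasFDerivAt.comp x₀ ?_
      exact Vᗮ.orthogonalProjectionOnto.hasFDerivAt.comp x₀ ((hasFDerivAt_id x₀).sub_const x₀)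
    convert h1 using 1
    ext1 y
    simp [add_comm]
  obtain ⟨g, hg, hgx₀, hg', hgΨ, hΨg⟩ := (hΨan x₀ hf).exists_local_inverse_of_hasFDerivAt_id hΨ'
  rw [hΨx₀] at hg hgx₀ hg' hgΨ
  have hgc : Tendsto g (nhds 0) (nhds x₀) := by
    have := hg.continuousAt.tendsto
    rwa [hgx₀] at this
  have hev := (hg.eventually_analyticAt.and (hgΨ.eventually_nhds)).and
    ((hgc.eventually hf.eventually_analyticAt).and
      ((hgc.eventually hfS.eventually_nhds).and (hgc.eventually hΨg.eventually_nhds)))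
  obtain ⟨r, hr, hball⟩ := Metric.eventually_nhds_iff_ball.1 hev
  have hPΨ : ∀ x, V.orthogonalProjectionOnto (Ψ x) = f x := by
    intro x
    have h1 : V.orthogonalProjectionOnto (Vᗮ.orthogonalProjectionOnto (x - x₀) : E) = 0 :=
      Submodule.orthogonalProjectionOnto_eq_zero_iff.2 (Vᗮ.orthogonalProjectionOnto (x - x₀)).2
    simp only [hΨdef, map_add, h1, zero_add,
      Submodule.orthogonalProjectionOnto_mem_subspace_eq_self]
  have hPΨ' : ∀ x, Vᗮ.orthogonalProjectionOnto (Ψ x) = Vᗮ.orthogonalProjectionOnto (x - x₀) := by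
    intro x
    have h1 : Vᗮ.orthogonalProjectionOnto (f x : E) = 0 :=
      Submodule.orthogonalProjectionOnto_eq_zero_iff.2 (V.le_orthogonal_orthogonal (f x).2)
    simp only [hΨdef, map_add, h1, add_zero,
      Submodule.orthogonalProjectionOnto_mem_subspace_eq_self]
  refine ⟨Vᗮ, g, fun x => Vᗮ.orthogonalProjectionOnto (x - x₀), r, hr, hgx₀,
    fun y hy => (hball y hy).1.1, hg', fun t ht hgt => ?_⟩
  obtain ⟨⟨h1, h2⟩, h3, h4, h5⟩ := hball t ht
  refine ⟨hπan _, ?_, ?_, ?_⟩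
  · filter_upwards [h2] with y hy
    rw [← hPΨ', hy]
  · filter_upwards [h4, h5] with x hx4 hx5 hxS
    conv_rhs => rw [← hx5]
    simp [hΨdef, hx4 hxS]
  · intro h hh hhS u hu
    refine fderiv_apply_eq_zero_of_finrank_conormal_le h3 h4 ?_ (hmax _ hgt) hh hhS hu
    have h6 : (fun y => f (g y)) =ᶠ[nhds (t : E)] V.orthogonalProjectionOnto := by
      filter_upwards [h2] with y hy
      rw [← hPΨ, hy]
    rw [← fderiv_comp (t : E) h3.differentiableAt h1.differentiableAt]
    exact h6.fderiv_eq.trans (ContinuousLinearMap.fderiv _)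

end Conormal

section Variety

variable {E : Type*} [NormedAddCommGroup E] [InnerProductSpace ℝ E]

theorem eqOn_zero_of_iteratedFDeriv_eq_zero {T G : Type*} [NormedAddCommGroup T] [NormedSpace ℝ T]
    [NormedAddCommGroup G] [NormedSpace ℝ G] [CompleteSpace G] {H : T → G} {r : ℝ} {x : T}
    (hr : 0 < r) (hH : AnalyticOnNhd ℝ H (ball x r)) (h0 : ∀ n, iteratedFDeriv ℝ n H x = 0) :
    EqOn H 0 (ball x r) := by
  refine hH.eqOn_zero_of_preconnected_of_eventuallyEq_zero (convex_ball x r).isPreconnected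
    (mem_ball_self hr) ?_
  obtain ⟨p, R, hp⟩ := hH x (mem_ball_self hr)
  filter_upwards [Metric.eball_mem_nhds x hp.r_pos] with y hy
  have hy' : y - x ∈ eball (0 : T) R := by
    rw [mem_eball, edist_eq_enorm_sub] at hy ⊢
    simpa using hy
  have h1 := hp.hasSum_iteratedFDeriv hy'
  simp only [h0, zero_apply, smul_zero, add_sub_cancel] at h1
  exact h1.unique hasSum_zero

/-- A nonempty common zero set of real analytic functions is a submanifold near one of its
points. -/
theorem exists_chart_of_analytic [FiniteDimensional ℝ E] {S : Set E} (hS : S.Nonempty) {ι : Type*}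
    {F : ι → E → ℝ} (hF : ∀ i, AnalyticOnNhd ℝ (F i) univ) (hFS : ∀ x, x ∈ S ↔ ∀ i, F i x = 0) :
    ∃ (T : Submodule ℝ E) (g : T → E), (∀ᶠ t in nhds 0, g t ∈ S) ∧
      (∀ ε : ℝ, 0 < ε → ∃ δ : ℝ, 0 < δ ∧ ∀ a ∈ ball (0 : T) δ, ∀ b ∈ ball (0 : T) δ,
        (1 - ε) * ‖a - b‖ ≤ ‖g a - g b‖ ∧ ‖g a - g b‖ ≤ (1 + ε) * ‖a - b‖) ∧
      (∀ W ∈ nhds (0 : T), ∀ᶠ y in nhds (g 0), y ∈ S → y ∈ g '' W) := by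
  obtain ⟨x₀, hx₀, hmax⟩ : ∃ x₀ ∈ S, ∀ x ∈ S,
      Module.finrank ℝ (conormal S x) ≤ Module.finrank ℝ (conormal S x₀) := by
    have hfin : ((fun x => Module.finrank ℝ (conormal S x)) '' S).Finite :=
      (finite_Iic (Module.finrank ℝ E)).subset (by
        rintro _ ⟨x, -, rfl⟩
        exact Submodule.finrank_le _)
    obtain ⟨_, ⟨x₀, hx₀, rfl⟩, h⟩ := hfin.exists_maximal (hS.image _) |>.imp fun a h => h
    refine ⟨x₀, hx₀, fun x hx => ?_⟩
    by_contra! hlt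
    exact absurd (h ⟨x, hx, rfl⟩ hlt.le) (not_le.2 hlt)
  obtain ⟨T, g, π, r, hr, hg0, hgan, hg', hT⟩ := exists_straightening hx₀ hmax
  have hmemT : ∀ t : T, t ∈ ball (0 : T) r → (t : E) ∈ ball (0 : E) r := fun t ht => by
    simpa using ht
  have hstable : ∀ {G : Type _} [NormedAddCommGroup G] [NormedSpace ℝ G] (H : T → G),
      AnalyticOnNhd ℝ H (ball 0 r) → (∀ t ∈ ball (0 : T) r, g t ∈ S → H t = 0) →
      ∀ t ∈ ball (0 : T) r, g t ∈ S → ‖fderiv ℝ H t‖ = 0 := by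
    intro G _ _ H hH hHS t ht hgt
    obtain ⟨h1, h2, h3, h4⟩ := hT t (hmemT t ht) hgt
    suffices h : fderiv ℝ H t = 0 by
      rw [h]
      exact ContinuousLinearMap.opNorm_zero
    ext u
    rw [SeparatingDual.eq_iff_forall_dual_eq (R := ℝ)]
    intro l
    have hπt : π (g t) = t := by
      rw [h2.self_of_nhds, Submodule.orthogonalProjectionOnto_mem_subspace_eq_self]
    have hHt := hH t ht
    have hHan : AnalyticAt ℝ (fun s => l (H s)) t := (l.analyticAt _).comp hHt
    have h5 : AnalyticAt ℝ (fun x => l (H (π x))) (g t) :=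
      AnalyticAt.fun_comp (g := fun s => l (H s)) (by rwa [hπt]) h1
    have hcont : ∀ᶠ x in nhds (g t), π x ∈ ball (0 : T) r := by
      refine h1.continuousAt.eventually_mem ?_
      rw [hπt]
      exact isOpen_ball.mem_nhds ht
    have h6 := h4 _ h5 (by
      filter_upwards [h3, hcont] with x hx hx' hxS
      rw [hHS _ hx' (by rwa [hx hxS]), map_zero]) u u.2
    have h7 : fderiv ℝ (fun y => l (H (π (g y)))) (t : E) =
        fderiv ℝ (fun y => l (H (T.orthogonalProjectionOnto y))) (t : E) := by
      refine Filter.EventuallyEq.fderiv_eq ?_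
      filter_upwards [h2] with y hy
      rw [hy]
    have h8 := fderiv_comp (t : E) (h5.differentiableAt)
      (hgan t (hmemT t ht)).differentiableAt
    have h9 : HasFDerivAt (fun y => l (H (T.orthogonalProjectionOnto y)))
        ((l.comp (fderiv ℝ H t)).comp T.orthogonalProjectionOnto) (t : E) := by
      have hP : T.orthogonalProjectionOnto (t : E) = t :=
        Submodule.orthogonalProjectionOnto_mem_subspace_eq_self t
      have h11 : HasFDerivAt (fun s => l (H s)) (l.comp (fderiv ℝ H t))
          (T.orthogonalProjectionOnto (t : E)) := by
        rw [hP]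
        exact l.hasFDerivAt.comp t hHt.differentiableAt.hasFDerivAt
      exact h11.comp (t : E) T.orthogonalProjectionOnto.hasFDerivAt
    have h10 := congrArg (fun L : E →L[ℝ] ℝ => L u) (h8.symm.trans (h7.trans h9.fderiv))
    simp only [ContinuousLinearMap.comp_apply, h6,
      Submodule.orthogonalProjectionOnto_mem_subspace_eq_self] at h10
    simpa using h10.symm
  have hzero : ∀ H : T → ℝ, AnalyticOnNhd ℝ H (ball 0 r) →
      (∀ t ∈ ball (0 : T) r, g t ∈ S → H t = 0) → EqOn H 0 (ball 0 r) := by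
    intro H hH hHS
    have hn : ∀ n, ∀ t ∈ ball (0 : T) r, g t ∈ S → iteratedFDeriv ℝ n H t = 0 := by
      intro n
      induction n with
      | zero =>
        intro t ht hgt
        ext
        simp [hHS t ht hgt]
      | succ n ih =>
        intro t ht hgt
        rw [← norm_eq_zero, ← norm_fderiv_iteratedFDeriv]
        exact hstable _ (hH.iteratedFDeriv n) ih t ht hgt
    refine eqOn_zero_of_iteratedFDeriv_eq_zero hr hH fun n => hn n 0 (mem_ball_self hr) ?_
    simpa [hg0] using hx₀
  have hgS : ∀ t ∈ ball (0 : T) r, g t ∈ S := by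
    intro t ht
    rw [hFS]
    intro i
    refine hzero (fun s => F i (g s)) (fun s hs => ?_) (fun s hs hgs => (hFS _).1 hgs i) ht
    exact (hF i _ (mem_univ _)).fun_comp ((hgan s (hmemT s hs)).fun_comp (T.subtypeL.analyticAt s))
  have h0 := hT 0 (by simpa using hr) (by simpa [hg0] using hx₀)
  refine ⟨T, fun t => g t, Filter.mem_of_superset (ball_mem_nhds _ hr) hgS, fun ε hε => ?_,
    fun W hW => ?_⟩
  · have hs : HasStrictFDerivAt g (ContinuousLinearMap.id ℝ E) 0 := by
      have := (hgan 0 (mem_ball_self hr)).hasStrictFDerivAt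
      rwa [hg'.fderiv] at this
    have hsmall := (Asymptotics.isLittleO_iff.1 hs.isLittleO hε)
    obtain ⟨δ, hδ, hball⟩ := Metric.eventually_nhds_iff_ball.1 hsmall
    refine ⟨δ, hδ, fun a ha b hb => ?_⟩
    have h1 := hball ((a : E), (b : E)) (by
      rw [← ball_prod_same]
      exact ⟨by simpa using ha, by simpa using hb⟩)
    simp only [ContinuousLinearMap.id_apply] at h1
    have h2 : ‖a - b‖ = ‖(a : E) - b‖ := rfl
    rw [h2]
    have h3 := norm_sub_norm_le (g a - g b) ((a : E) - b)
    have h4 := norm_sub_norm_le ((a : E) - b) (g a - g b)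
    rw [norm_sub_rev ((a : E) - b)] at h4
    constructor <;> nlinarith
  · obtain ⟨h1, h2, h3, -⟩ := h0
    have hπ0 : π (g (0 : T)) = 0 := by
      rw [h2.self_of_nhds]; simp
    have hπc : ∀ᶠ x in nhds (g (0 : T)), π x ∈ W :=
      h1.continuousAt.eventually_mem (by rwa [hπ0])
    filter_upwards [h3, hπc] with x hx hxW hxS
    exact ⟨π x, hxW, hx hxS⟩

end Variety

theorem IsDistributionFunction.exists_hasDim0 {d : ℕ} {μ : Measure (Euc d)}
    [IsLocallyFiniteMeasure μ] {φ : ℝ → ENNReal} (hφ : IsDistributionFunction μ φ)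
    (h0 : 0 ∈ msupport μ) : ∃ n ≤ d, HasDim0 φ n := by
  obtain ⟨T, g, h1, h2, h3⟩ := exists_chart_of_analytic (S := msupport μ) ⟨0, h0⟩
    (ι := {s : ℝ // 1 ≤ s})
    (F := fun s x => ∫ z, Real.exp (-s * ‖z - x‖ ^ 2) ∂μ - ∫ z, Real.exp (-s * ‖z - 0‖ ^ 2) ∂μ)
    (fun s x _ => (hφ.analyticAt_integral_gaussian h0 (one_pos.trans_le s.2) x).sub
      analyticAt_const)
    (fun x => ⟨fun hx s => sub_eq_zero.2
      (hφ.integral_gaussian_congr hx h0 (one_pos.trans_le s.2)), fun h =>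
        hφ.mem_msupport_of_integral_gaussian_eq h0 fun s hs => sub_eq_zero.1 (h ⟨s, hs⟩)⟩)
  refine ⟨Module.finrank ℝ T, ?_, hφ.hasDim0_of_chart h1 h2 h3⟩
  simpa using Submodule.finrank_le T

/-- On any set, the squared norm agrees, up to a linear form, with a combination of squares of
inner products with points of the set whose weighted sum is zero. -/
theorem exists_sq_norm_eq_sum_inner_sq {d : ℕ} (S : Set (Euc d)) :
    ∃ (c : S →₀ ℝ) (b : Euc d), (c.sum fun x a => a • (x : Euc d)) = 0 ∧
      ∀ z ∈ S, ‖z‖ ^ 2 = (c.sum fun x a => a * inner ℝ (x : Euc d) z ^ 2) + inner ℝ b z := by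
  let q : Euc d → EuclideanSpace ℝ (Fin d × Fin d) := fun z =>
    WithLp.toLp 2 fun i => z i.1 * z i.2
  have hq : ∀ x z, inner ℝ (q x) (q z) = inner ℝ x z ^ 2 := by
    intro x z
    simp only [PiLp.inner_apply, q, sq, Finset.sum_mul_sum, Fintype.sum_prod_type]
    refine Finset.sum_congr rfl fun i _ => Finset.sum_congr rfl fun j _ => ?_
    simp only [inner]
    simp
    ring
  let D : EuclideanSpace ℝ (Fin d × Fin d) := WithLp.toLp 2 fun i => if i.1 = i.2 then 1 else 0
  have hD : ∀ z, inner ℝ D (q z) = ‖z‖ ^ 2 := by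
    intro z
    rw [EuclideanSpace.real_norm_sq_eq]
    simp [PiLp.inner_apply, q, D, Fintype.sum_prod_type, sq]
  let p : S → Euc d × EuclideanSpace ℝ (Fin d × Fin d) := fun x => (x, q x)
  set V := Submodule.span ℝ (range p) with hV
  let V₀ := V.comap (LinearMap.inr ℝ (Euc d) (EuclideanSpace ℝ (Fin d × Fin d)))
  let N := V₀.orthogonalProjectionOnto D
  have hN : (0, (N : EuclideanSpace ℝ (Fin d × Fin d))) ∈ V := N.2
  let F : V →ₗ[ℝ] ℝ := (innerₛₗ ℝ (D - N)).comp
    ((LinearMap.snd ℝ (Euc d) (EuclideanSpace ℝ (Fin d × Fin d))).comp V.subtype)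
  let f : V →ₗ[ℝ] Euc d := (LinearMap.fst ℝ (Euc d) _).comp V.subtype
  have hF : F ∈ LinearMap.range f.dualMap := by
    rw [LinearMap.range_dualMap_eq_dualAnnihilator_ker, Submodule.mem_dualAnnihilator]
    rintro ⟨⟨y, M⟩, hyM⟩ hy
    have hy0 : y = 0 := hy
    subst hy0
    have hM : M ∈ V₀ := hyM
    have := Submodule.sub_starProjection_mem_orthogonal (K := V₀) D
    exact Submodule.inner_left_of_mem_orthogonal hM this
  obtain ⟨l, hl⟩ := hF
  obtain ⟨c, hc⟩ := Finsupp.mem_span_range_iff_exists_finsupp.1 hN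
  have hc1 := congrArg (LinearMap.fst ℝ (Euc d) (EuclideanSpace ℝ (Fin d × Fin d))) hc
  have hc2 := congrArg (LinearMap.snd ℝ (Euc d) (EuclideanSpace ℝ (Fin d × Fin d))) hc
  simp only [Finsupp.sum, map_sum, map_smul] at hc1 hc2
  refine ⟨c, (InnerProductSpace.toDual ℝ (Euc d)).symm l.toContinuousLinearMap, hc1,
    fun z hz => ?_⟩
  have h1 := congrArg (fun L : V →ₗ[ℝ] ℝ => L ⟨p ⟨z, hz⟩, Submodule.subset_span ⟨_, rfl⟩⟩) hl
  have h2 : l z = inner ℝ (D - N) (q z) := h1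
  have h3 : inner ℝ (N : EuclideanSpace ℝ (Fin d × Fin d)) (q z) =
      c.sum fun x a => a * inner ℝ (x : Euc d) z ^ 2 := by
    have h4 : (N : EuclideanSpace ℝ (Fin d × Fin d)) = c.sum fun x a => a • q x := hc2.symm
    rw [h4, Finsupp.sum, sum_inner]
    exact Finset.sum_congr rfl fun x _ => by rw [real_inner_smul_left, hq]
  rw [InnerProductSpace.toDual_symm_apply, LinearMap.coe_toContinuousLinearMap', h2, ← h3,
    inner_sub_left, hD]
  ring

theorem abs_exp_sub_taylor_two_le (u : ℝ) :
    |Real.exp u - (1 + u + u ^ 2 / 2)| ≤ |u| ^ 3 * Real.exp |u| := by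
  have h := Complex.norm_exp_sub_sum_le_norm_mul_exp (u : ℂ) 3
  simp only [Finset.sum_range_succ, Finset.sum_range_zero, Complex.norm_real,
    Real.norm_eq_abs] at h
  rw [← Real.norm_eq_abs (Real.exp u - _), ← Complex.norm_real]
  convert h using 2
  push_cast
  simp [Nat.factorial]

theorem abs_exp_sub_one_sub_le (u : ℝ) :
    |Real.exp u - (1 + u)| ≤ |u| ^ 2 * Real.exp |u| := by
  have h := Complex.norm_exp_sub_sum_le_norm_mul_exp (u : ℂ) 2
  simp only [Finset.sum_range_succ, Finset.sum_range_zero, Complex.norm_real,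
    Real.norm_eq_abs] at h
  rw [← Real.norm_eq_abs (Real.exp u - _), ← Complex.norm_real]
  convert h using 2
  push_cast
  simp [Nat.factorial]

theorem pow_three_mul_exp_le {m s t u : ℝ} (hm : 0 ≤ m) (hs : 0 < s) (hs1 : s ≤ 1) (ht : 0 ≤ t)
    (hu : |u| ≤ 2 * s * m * t) :
    |u| ^ 3 * Real.exp |u| ≤
      48 * m ^ 3 * Real.exp ((2 * m + 1) ^ 2 / 3) * (s * √s) * Real.exp (3 / 4 * s * t ^ 2) := by
  set τ := √s * t with hτ
  have hτ0 : 0 ≤ τ := by positivity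
  have hss : √s * √s = s := Real.mul_self_sqrt hs.le
  have hs' : √s ≤ 1 := Real.sqrt_le_one.2 hs1
  have h1 : |u| ≤ 2 * m * τ * √s := by
    calc |u| ≤ 2 * (√s * √s) * m * t := by rwa [hss]
      _ = _ := by rw [hτ]; ring
  have h2 : |u| ≤ 2 * m * τ := h1.trans (mul_le_of_le_one_right (by positivity) hs')
  have h3 : τ ^ 3 ≤ 6 * Real.exp τ := by
    have := Real.pow_div_factorial_le_exp τ hτ0 3
    rw [div_le_iff₀ (by positivity)] at this
    simpa [Nat.factorial, mul_comm] using this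
  calc |u| ^ 3 * Real.exp |u| ≤ (2 * m * τ * √s) ^ 3 * Real.exp (2 * m * τ) := by gcongr
    _ = 8 * m ^ 3 * (s * √s) * (τ ^ 3 * Real.exp (2 * m * τ)) := by
        rw [mul_pow, mul_pow, mul_pow, show √s ^ 3 = s * √s by rw [pow_succ, sq, hss]]
        ring
    _ ≤ 8 * m ^ 3 * (s * √s) * (6 * Real.exp τ * Real.exp (2 * m * τ)) := by gcongr
    _ = 48 * m ^ 3 * (s * √s) * Real.exp (τ + 2 * m * τ) := by rw [Real.exp_add]; ring
    _ ≤ 48 * m ^ 3 * (s * √s) * Real.exp ((2 * m + 1) ^ 2 / 3 + 3 / 4 * s * t ^ 2) := by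
        have h4 : s * t ^ 2 = τ ^ 2 := by rw [hτ, mul_pow, Real.sq_sqrt hs.le]
        have h5 : τ + 2 * m * τ ≤ (2 * m + 1) ^ 2 / 3 + 3 / 4 * s * t ^ 2 := by
          rw [mul_assoc (3 / 4), h4]
          nlinarith [sq_nonneg (2 * (2 * m + 1) - 3 * τ)]
        gcongr
    _ = _ := by rw [Real.exp_add]; ring

/-- The integral of the Gaussian `exp (-s ‖z‖ ^ 2)`. -/
def gaussianMass {d : ℕ} (μ : Measure (Euc d)) (s : ℝ) : ℝ := ∫ z, Real.exp (-s * ‖z‖ ^ 2) ∂μ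

namespace IsDistributionFunction

variable {d : ℕ} {μ : Measure (Euc d)} {φ : ℝ → ENNReal}

theorem gaussianMass_pos (hφ : IsDistributionFunction μ φ) (h0 : 0 ∈ msupport μ) {s : ℝ}
    (hs : 0 < s) : 0 < gaussianMass μ s := by
  simpa [gaussianMass] using hφ.integral_gaussian_pos h0 hs

theorem gaussianMass_quarter_le (hφ : IsDistributionFunction μ φ) (h0 : 0 ∈ msupport μ) {s : ℝ}
    (hs : 0 < s) : gaussianMass μ (s / 4) ≤ 5 ^ d * gaussianMass μ s := by
  simpa [gaussianMass] using hφ.integral_gaussian_quarter_le h0 hs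

theorem integrable_pow_mul_gaussian (hφ : IsDistributionFunction μ φ) (h0 : 0 ∈ msupport μ)
    {s : ℝ} (hs : 0 < s) (n : ℕ) :
    Integrable (fun z => ‖z‖ ^ n * Real.exp (-s * ‖z‖ ^ 2)) μ :=
  integrable_norm_pow_mul (fun z => (Real.exp_pos _).le) (by fun_prop)
    (fun a => hφ.integrable_exp_mul_gaussian h0 hs a) n

theorem integrable_inner_pow_mul_gaussian (hφ : IsDistributionFunction μ φ)
    (h0 : 0 ∈ msupport μ) {s : ℝ} (hs : 0 < s) (x : Euc d) (n : ℕ) :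
    Integrable (fun z => inner ℝ x z ^ n * Real.exp (-s * ‖z‖ ^ 2)) μ := by
  refine ((hφ.integrable_pow_mul_gaussian h0 hs n).const_mul (‖x‖ ^ n)).mono' (by fun_prop)
    (ae_of_all _ fun z => ?_)
  rw [norm_mul, norm_pow, Real.norm_eq_abs, Real.norm_of_nonneg (Real.exp_pos _).le, ← mul_assoc,
    ← mul_pow]
  gcongr
  exact abs_real_inner_le_norm x z

/-- Second order expansion of the translation invariance of the Gaussian integral. -/
theorem exists_abs_inner_expansion_le (hφ : IsDistributionFunction μ φ) (h0 : 0 ∈ msupport μ)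
    {x : Euc d} (hx : x ∈ msupport μ) :
    ∃ K : ℝ, 0 ≤ K ∧ ∀ s : ℝ, 0 < s → s ≤ 1 →
      |2 * s * ∫ z, inner ℝ x z * Real.exp (-s * ‖z‖ ^ 2) ∂μ +
        2 * s ^ 2 * ∫ z, inner ℝ x z ^ 2 * Real.exp (-s * ‖z‖ ^ 2) ∂μ -
        s * ‖x‖ ^ 2 * gaussianMass μ s| ≤ K * (s * √s) * gaussianMass μ s := by
  set m := ‖x‖ with hm
  set C := 48 * m ^ 3 * Real.exp ((2 * m + 1) ^ 2 / 3) with hC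
  refine ⟨C * 5 ^ d + m ^ 4 * Real.exp (m ^ 2), by positivity, fun s hs hs1 => ?_⟩
  have hI := hφ.gaussianMass_pos h0 hs
  have hi0 : Integrable (fun z : Euc d => Real.exp (-s * ‖z‖ ^ 2)) μ := by
    simpa using hφ.integrable_pow_mul_gaussian h0 hs 0
  have hi1 := hφ.integrable_inner_pow_mul_gaussian h0 hs x 1
  have hi2 := hφ.integrable_inner_pow_mul_gaussian h0 hs x 2
  simp only [pow_one] at hi1
  have hexp : ∀ z : Euc d, Real.exp (2 * s * inner ℝ x z) * Real.exp (-s * ‖z‖ ^ 2) =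
      Real.exp (s * m ^ 2) * Real.exp (-s * ‖z - x‖ ^ 2) := by
    intro z
    rw [← Real.exp_add, ← Real.exp_add, norm_sub_sq_real, real_inner_comm, ← hm]
    congr 1
    ring
  have hie : Integrable (fun z : Euc d =>
      Real.exp (2 * s * inner ℝ x z) * Real.exp (-s * ‖z‖ ^ 2)) μ := by
    simp only [hexp]
    exact (hφ.integrable_gaussian hx hs).const_mul _
  have hE : ∫ z, Real.exp (2 * s * inner ℝ x z) * Real.exp (-s * ‖z‖ ^ 2) ∂μ =
      Real.exp (s * m ^ 2) * gaussianMass μ s := by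
    simp only [hexp, integral_const_mul]
    rw [hφ.integral_gaussian_congr hx h0 hs]
    simp [gaussianMass]
  have hR : ∫ z, (Real.exp (2 * s * inner ℝ x z) - (1 + 2 * s * inner ℝ x z +
      (2 * s * inner ℝ x z) ^ 2 / 2)) * Real.exp (-s * ‖z‖ ^ 2) ∂μ =
      Real.exp (s * m ^ 2) * gaussianMass μ s - (gaussianMass μ s +
        2 * s * ∫ z, inner ℝ x z * Real.exp (-s * ‖z‖ ^ 2) ∂μ +
        2 * s ^ 2 * ∫ z, inner ℝ x z ^ 2 * Real.exp (-s * ‖z‖ ^ 2) ∂μ) := by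
    have hi01 : Integrable (fun z => Real.exp (-s * ‖z‖ ^ 2) +
        2 * s * (inner ℝ x z * Real.exp (-s * ‖z‖ ^ 2))) μ := hi0.add (hi1.const_mul _)
    have hi012 : Integrable (fun z => Real.exp (-s * ‖z‖ ^ 2) +
        2 * s * (inner ℝ x z * Real.exp (-s * ‖z‖ ^ 2)) +
        2 * s ^ 2 * (inner ℝ x z ^ 2 * Real.exp (-s * ‖z‖ ^ 2))) μ :=
      hi01.add (hi2.const_mul _)
    rw [← hE, gaussianMass, ← integral_const_mul, ← integral_const_mul,
      ← integral_add hi0 (hi1.const_mul _), ← integral_add hi01 (hi2.const_mul _),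
      ← integral_sub hie hi012]
    congr 1
    ext z
    ring
  have hRle : |∫ z, (Real.exp (2 * s * inner ℝ x z) - (1 + 2 * s * inner ℝ x z +
      (2 * s * inner ℝ x z) ^ 2 / 2)) * Real.exp (-s * ‖z‖ ^ 2) ∂μ| ≤
      C * (s * √s) * (5 ^ d * gaussianMass μ s) := by
    have hi4 : Integrable (fun z : Euc d => Real.exp (-(s / 4) * ‖z‖ ^ 2)) μ := by
      simpa using hφ.integrable_pow_mul_gaussian h0 (show 0 < s / 4 by positivity) 0
    rw [← Real.norm_eq_abs]
    refine (norm_integral_le_of_norm_le (hi4.const_mul (C * (s * √s)))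
      (ae_of_all _ fun z => ?_)).trans ?_
    · rw [norm_mul, Real.norm_eq_abs, Real.norm_of_nonneg (Real.exp_pos _).le]
      have hu : |2 * s * inner ℝ x z| ≤ 2 * s * m * ‖z‖ := by
        rw [abs_mul, abs_of_pos (by positivity : 0 < 2 * s), mul_assoc (2 * s)]
        gcongr
        exact abs_real_inner_le_norm x z
      calc _ ≤ (C * (s * √s) * Real.exp (3 / 4 * s * ‖z‖ ^ 2)) * Real.exp (-s * ‖z‖ ^ 2) := by
            gcongr
            exact (abs_exp_sub_taylor_two_le _).trans
              (pow_three_mul_exp_le (norm_nonneg x) hs hs1 (norm_nonneg z) hu)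
        _ = _ := by
            rw [mul_assoc (C * _), ← Real.exp_add]
            congr 2
            ring
    · rw [integral_const_mul]
      gcongr
      exact hφ.gaussianMass_quarter_le h0 hs
  have hsq : s ^ 2 ≤ s * √s := by
    rw [sq]
    gcongr
    exact Real.le_sqrt_of_sq_le (by nlinarith)
  have hT : |Real.exp (s * m ^ 2) - (1 + s * m ^ 2)| ≤ m ^ 4 * Real.exp (m ^ 2) * (s * √s) := by
    refine (abs_exp_sub_one_sub_le _).trans ?_
    rw [abs_of_nonneg (by positivity)]
    calc (s * m ^ 2) ^ 2 * Real.exp (s * m ^ 2) ≤ (s * m ^ 2) ^ 2 * Real.exp (m ^ 2) := by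
          gcongr
          exact mul_le_of_le_one_left (by positivity) hs1
      _ = m ^ 4 * Real.exp (m ^ 2) * s ^ 2 := by ring
      _ ≤ _ := by gcongr
  rw [hR] at hRle
  have hT' : |(Real.exp (s * m ^ 2) - (1 + s * m ^ 2)) * gaussianMass μ s| ≤
      m ^ 4 * Real.exp (m ^ 2) * (s * √s) * gaussianMass μ s := by
    rw [abs_mul, abs_of_pos hI]
    gcongr
  rw [abs_le] at hRle hT' ⊢
  constructor <;> nlinarith [hRle.1, hRle.2, hT'.1, hT'.2]

end IsDistributionFunction

/-- A positive function whose logarithmic derivative is close to `-p / (2 s)` is comparable to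
`s ^ (-p / 2)` near zero. -/
theorem exists_tendsto_rpow_mul_of_abs_sub_le {G J : ℝ → ℝ} {p K : ℝ} (hK : 0 ≤ K)
    (hG : ∀ s, 0 < s → 0 < G s) (hd : ∀ s, 0 < s → HasDerivAt G (-J s) s)
    (h : ∀ s, 0 < s → s ≤ 1 → |2 * s * J s - p * G s| ≤ K * √s * G s) :
    ∃ c : ℝ, 0 < c ∧ Tendsto (fun s : ℝ => s ^ (p / 2) * G s) (nhdsWithin 0 (Ioi 0)) (nhds c) := by
  set H : ℝ → ℝ := fun s => Real.log (G s) + p / 2 * Real.log s with hH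
  have hHd : ∀ s, 0 < s → HasDerivAt H (-J s / G s + p / 2 * s⁻¹) s := fun s hs =>
    ((hd s hs).log (hG s hs).ne').add ((Real.hasDerivAt_log hs.ne').const_mul _)
  have hKd : ∀ s : ℝ, 0 < s → HasDerivAt (fun s => K * √s) (K * (1 / (2 * √s))) s := fun s hs =>
    (Real.hasDerivAt_sqrt hs.ne').const_mul _
  have hbound : ∀ s, 0 < s → s ≤ 1 → |-J s / G s + p / 2 * s⁻¹| ≤ K * (1 / (2 * √s)) := by
    intro s hs hs1
    have hGs := hG s hs
    have h1 : -J s / G s + p / 2 * s⁻¹ = -(2 * s * J s - p * G s) / (2 * s * G s) := by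
      field_simp
      ring
    have h2 : K * (1 / (2 * √s)) = K * √s * G s / (2 * s * G s) := by
      have h3 : 0 < √s := Real.sqrt_pos.2 hs
      field_simp
      rw [Real.sq_sqrt hs.le]
    rw [h1, h2, abs_div, abs_neg, abs_of_pos (show 0 < 2 * s * G s by positivity)]
    gcongr
    exact h s hs hs1
  have hmono : MonotoneOn (fun s => H s + K * √s) (Ioc 0 1) := by
    have hda : ∀ s, 0 < s → HasDerivAt (fun s => H s + K * √s)
        ((-J s / G s + p / 2 * s⁻¹) + K * (1 / (2 * √s))) s := fun s hs =>
      (hHd s hs).add (hKd s hs)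
    refine monotoneOn_of_deriv_nonneg (convex_Ioc 0 1)
      (fun s hs => (hda s hs.1).continuousAt.continuousWithinAt) ?_ ?_ <;>
      rw [interior_Ioc] <;> intro s hs
    · exact (hda s hs.1).differentiableAt.differentiableWithinAt
    · rw [(hda s hs.1).deriv]
      linarith [(abs_le.1 (hbound s hs.1 hs.2.le)).1]
  have hanti : AntitoneOn (fun s => H s - K * √s) (Ioc 0 1) := by
    have hda : ∀ s, 0 < s → HasDerivAt (fun s => H s - K * √s)
        ((-J s / G s + p / 2 * s⁻¹) - K * (1 / (2 * √s))) s := fun s hs =>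
      (hHd s hs).sub (hKd s hs)
    refine antitoneOn_of_deriv_nonpos (convex_Ioc 0 1)
      (fun s hs => (hda s hs.1).continuousAt.continuousWithinAt) ?_ ?_ <;>
      rw [interior_Ioc] <;> intro s hs
    · exact (hda s hs.1).differentiableAt.differentiableWithinAt
    · rw [(hda s hs.1).deriv]
      linarith [(abs_le.1 (hbound s hs.1 hs.2.le)).2]
  have hbdd : BddBelow ((fun s => H s + K * √s) '' Ioo 0 1) := by
    refine ⟨H 1 - K * √1, ?_⟩
    rintro _ ⟨s, hs, rfl⟩
    have h1 := hanti ⟨hs.1, hs.2.le⟩ ⟨one_pos, le_rfl⟩ hs.2.le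
    have h2 : 0 ≤ K * √s := by positivity
    simp only at h1 ⊢
    linarith
  have hlim := (hmono.mono Ioo_subset_Ioc_self).tendsto_nhdsWithin_Ioo_right
    (nonempty_Ioo.2 one_pos) hbdd
  have hsq : Tendsto (fun s : ℝ => K * √s) (nhdsWithin 0 (Ioi 0)) (nhds 0) := by
    have : Continuous fun s : ℝ => K * √s := by fun_prop
    simpa using (this.tendsto 0).mono_left nhdsWithin_le_nhds
  have hH' := (Real.continuous_exp.tendsto _).comp (hlim.sub hsq)
  refine ⟨_, Real.exp_pos _, hH'.congr' ?_⟩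
  filter_upwards [self_mem_nhdsWithin] with s hs
  have hs' : 0 < s := hs
  simp only [Function.comp, add_sub_cancel_right, hH]
  rw [Real.exp_add, Real.exp_log (hG s hs), Real.rpow_def_of_pos hs', mul_comm (p / 2),
    mul_comm (Real.log s), mul_comm (p / 2), mul_comm]

namespace IsDistributionFunction

variable {d : ℕ} {μ : Measure (Euc d)} {φ : ℝ → ENNReal}

theorem sqrt_mul_abs_integral_inner_le (hφ : IsDistributionFunction μ φ) (h0 : 0 ∈ msupport μ)
    (b : Euc d) {s : ℝ} (hs : 0 < s) :
    √s * |∫ z, inner ℝ b z * Real.exp (-s * ‖z‖ ^ 2) ∂μ| ≤ ‖b‖ * 5 ^ d * gaussianMass μ s := by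
  have hi4 : Integrable (fun z : Euc d => Real.exp (-(s / 4) * ‖z‖ ^ 2)) μ := by
    simpa using hφ.integrable_pow_mul_gaussian h0 (show 0 < s / 4 by positivity) 0
  rw [← abs_of_nonneg (Real.sqrt_nonneg s), ← abs_mul, ← integral_const_mul, ← Real.norm_eq_abs]
  refine (norm_integral_le_of_norm_le (hi4.const_mul ‖b‖) (ae_of_all _ fun z => ?_)).trans ?_
  · rw [norm_mul, norm_mul, Real.norm_eq_abs, Real.norm_eq_abs,
      Real.norm_of_nonneg (Real.exp_pos _).le, abs_of_nonneg (Real.sqrt_nonneg s)]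
    have h1 : √s * ‖z‖ ≤ Real.exp (3 / 4 * (√s * ‖z‖) ^ 2) := by
      refine le_trans ?_ (Real.add_one_le_exp _)
      nlinarith [sq_nonneg (3 * (√s * ‖z‖) - 2)]
    rw [mul_pow, Real.sq_sqrt hs.le] at h1
    calc √s * (|inner ℝ b z| * Real.exp (-s * ‖z‖ ^ 2)) ≤
          √s * ((‖b‖ * ‖z‖) * Real.exp (-s * ‖z‖ ^ 2)) := by
          gcongr
          exact abs_real_inner_le_norm b z
      _ = ‖b‖ * ((√s * ‖z‖) * Real.exp (-s * ‖z‖ ^ 2)) := by ring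
      _ ≤ ‖b‖ * (Real.exp (3 / 4 * (s * ‖z‖ ^ 2)) * Real.exp (-s * ‖z‖ ^ 2)) := by gcongr
      _ = _ := by
        rw [← Real.exp_add]
        congr 2
        ring
  · rw [integral_const_mul, mul_assoc]
    gcongr
    exact hφ.gaussianMass_quarter_le h0 hs

/-- The second moment of the Gaussian weight is governed by its mass. -/
theorem exists_abs_second_moment_sub_le (hφ : IsDistributionFunction μ φ)
    (h0 : 0 ∈ msupport μ) :
    ∃ p K : ℝ, 0 ≤ K ∧ ∀ s : ℝ, 0 < s → s ≤ 1 →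
      |2 * s * ∫ z, ‖z‖ ^ 2 * Real.exp (-s * ‖z‖ ^ 2) ∂μ - p * gaussianMass μ s| ≤
        K * √s * gaussianMass μ s := by
  obtain ⟨c, b, hc, hcb⟩ := exists_sq_norm_eq_sum_inner_sq (msupport μ)
  choose K hK0 hK using fun x : msupport μ => hφ.exists_abs_inner_expansion_le h0 x.2
  have hKs : 0 ≤ ∑ x ∈ c.support, |c x| * K x :=
    Finset.sum_nonneg fun x _ => mul_nonneg (abs_nonneg _) (hK0 x)
  refine ⟨∑ x ∈ c.support, c x * ‖(x : Euc d)‖ ^ 2,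
    ∑ x ∈ c.support, |c x| * K x + 2 * (‖b‖ * 5 ^ d), by positivity, fun s hs hs1 => ?_⟩
  set G := gaussianMass μ s with hG
  have hi1 (x : Euc d) : Integrable (fun z => inner ℝ x z * Real.exp (-s * ‖z‖ ^ 2)) μ := by
    simpa using hφ.integrable_inner_pow_mul_gaussian h0 hs x 1
  have hi2 (x : Euc d) := hφ.integrable_inner_pow_mul_gaussian h0 hs x 2
  have hfirst : ∑ x ∈ c.support, c x * ∫ z, inner ℝ (x : Euc d) z *
      Real.exp (-s * ‖z‖ ^ 2) ∂μ = 0 := by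
    simp only [← integral_const_mul]
    rw [← integral_finsetSum _ fun (x : msupport μ) _ => (hi1 x).const_mul (c x)]
    simp only [← mul_assoc, ← Finset.sum_mul, ← real_inner_smul_left, ← sum_inner]
    rw [Finsupp.sum] at hc
    simp [hc]
  have hsecond : ∑ x ∈ c.support, c x * ∫ z, inner ℝ (x : Euc d) z ^ 2 *
      Real.exp (-s * ‖z‖ ^ 2) ∂μ = ∫ z, ‖z‖ ^ 2 * Real.exp (-s * ‖z‖ ^ 2) ∂μ -
        ∫ z, inner ℝ b z * Real.exp (-s * ‖z‖ ^ 2) ∂μ := by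
    simp only [← integral_const_mul]
    rw [← integral_finsetSum _ fun (x : msupport μ) _ => (hi2 x).const_mul (c x),
      ← integral_sub (hφ.integrable_pow_mul_gaussian h0 hs 2) (hi1 b)]
    refine integral_congr_ae ?_
    filter_upwards [ae_mem_msupport μ] with z hz
    rw [hcb z hz, Finsupp.sum, ← sub_mul, add_sub_cancel_right, Finset.sum_mul]
    exact Finset.sum_congr rfl fun x _ => by ring
  have hsum : |∑ x ∈ c.support, c x *
      (2 * s * ∫ z, inner ℝ (x : Euc d) z * Real.exp (-s * ‖z‖ ^ 2) ∂μ +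
        2 * s ^ 2 * ∫ z, inner ℝ (x : Euc d) z ^ 2 * Real.exp (-s * ‖z‖ ^ 2) ∂μ -
        s * ‖(x : Euc d)‖ ^ 2 * G)| ≤ (∑ x ∈ c.support, |c x| * K x) * (s * √s * G) := by
    refine (Finset.abs_sum_le_sum_abs _ _).trans ?_
    rw [Finset.sum_mul]
    gcongr with x hx
    rw [abs_mul]
    exact (mul_le_mul_of_nonneg_left (hK x s hs hs1) (abs_nonneg _)).trans_eq (by ring)
  have hexpand : ∑ x ∈ c.support, c x *
      (2 * s * ∫ z, inner ℝ (x : Euc d) z * Real.exp (-s * ‖z‖ ^ 2) ∂μ +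
        2 * s ^ 2 * ∫ z, inner ℝ (x : Euc d) z ^ 2 * Real.exp (-s * ‖z‖ ^ 2) ∂μ -
        s * ‖(x : Euc d)‖ ^ 2 * G) =
      s * (2 * s * (∫ z, ‖z‖ ^ 2 * Real.exp (-s * ‖z‖ ^ 2) ∂μ -
        ∫ z, inner ℝ b z * Real.exp (-s * ‖z‖ ^ 2) ∂μ) -
        (∑ x ∈ c.support, c x * ‖(x : Euc d)‖ ^ 2) * G) := by
    rw [← hsecond]
    have h2 := congrArg (fun t => 2 * s * t) hfirst
    simp only [mul_zero] at h2
    rw [← sub_eq_zero, ← h2]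
    simp only [mul_sub, Finset.mul_sum, Finset.sum_mul]
    rw [← Finset.sum_sub_distrib, ← Finset.sum_sub_distrib]
    refine Finset.sum_congr rfl fun x _ => ?_
    ring
  rw [hexpand, abs_mul, abs_of_pos hs, mul_assoc s, mul_left_comm _ s] at hsum
  have hb := hφ.sqrt_mul_abs_integral_inner_le h0 b hs
  have hb' : |2 * s * ∫ z, inner ℝ b z * Real.exp (-s * ‖z‖ ^ 2) ∂μ| ≤
      2 * √s * (‖b‖ * 5 ^ d * G) := by
    rw [abs_mul, abs_of_pos (by positivity)]
    calc _ = 2 * √s * (√s * |∫ z, inner ℝ b z * Real.exp (-s * ‖z‖ ^ 2) ∂μ|) := by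
          rw [← mul_assoc (2 * √s), mul_assoc 2 √s, Real.mul_self_sqrt hs.le]
      _ ≤ _ := by gcongr
  have hsum' := le_of_mul_le_mul_left hsum hs
  rw [abs_le] at hsum' hb' ⊢
  constructor <;> nlinarith [hsum'.1, hsum'.2, hb'.1, hb'.2]

theorem hasDerivAt_gaussianMass (hφ : IsDistributionFunction μ φ) (h0 : 0 ∈ msupport μ) {s : ℝ}
    (hs : 0 < s) :
    HasDerivAt (gaussianMass μ) (-∫ z, ‖z‖ ^ 2 * Real.exp (-s * ‖z‖ ^ 2) ∂μ) s := by
  have hs2 : 0 < s / 2 := by positivity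
  have hi0 : Integrable (fun z : Euc d => Real.exp (-s * ‖z‖ ^ 2)) μ := by
    simpa using hφ.integrable_pow_mul_gaussian h0 hs 0
  have h := (hasDerivAt_integral_of_dominated_loc_of_deriv_le (μ := μ) (x₀ := s)
    (F := fun s (z : Euc d) => Real.exp (-s * ‖z‖ ^ 2))
    (F' := fun s z => -(‖z‖ ^ 2 * Real.exp (-s * ‖z‖ ^ 2))) (Ioi_mem_nhds (half_lt_self hs))
    (Eventually.of_forall fun t => by fun_prop) hi0 (by fun_prop)
    (ae_of_all _ fun z t ht => ?_) (hφ.integrable_pow_mul_gaussian h0 hs2 2)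
    (ae_of_all _ fun z t _ => ?_)).2
  · rwa [integral_neg] at h
  · rw [norm_neg, Real.norm_of_nonneg (by positivity)]
    have ht' : s / 2 ≤ t := le_of_lt ht
    gcongr
  · convert! ((hasDerivAt_neg t).mul_const (‖z‖ ^ 2)).exp using 1
    ring

/-- The Gaussian mass is asymptotic to a negative power of the parameter at zero. -/
theorem exists_tendsto_gaussianMass (hφ : IsDistributionFunction μ φ) (h0 : 0 ∈ msupport μ) :
    ∃ p c : ℝ, 0 < c ∧
      Tendsto (fun s : ℝ => s ^ (p / 2) * gaussianMass μ s) (nhdsWithin 0 (Ioi 0)) (nhds c) := by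
  obtain ⟨p, K, hK, h⟩ := hφ.exists_abs_second_moment_sub_le h0
  exact ⟨p, exists_tendsto_rpow_mul_of_abs_sub_le hK (fun s hs => hφ.gaussianMass_pos h0 hs)
    (fun s hs => hφ.hasDerivAt_gaussianMass h0 hs) h⟩

end IsDistributionFunction

theorem exists_tendsto_of_forall_approx {α : Type*} {l : Filter α} [l.NeBot] {q : α → ℝ}
    (h : ∀ ε : ℝ, 0 < ε → ∃ (f : α → ℝ) (a : ℝ), Tendsto f l (nhds a) ∧
      ∀ᶠ r in l, |q r - f r| ≤ ε) : ∃ a, Tendsto q l (nhds a) := by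
  refine cauchy_map_iff_exists_tendsto.1 (Metric.cauchy_iff.2 ⟨inferInstance, fun ε hε => ?_⟩)
  obtain ⟨f, a, hf, hq⟩ := h (ε / 5) (by positivity)
  have hf' := hf.eventually (Metric.closedBall_mem_nhds a (show 0 < ε / 5 by positivity))
  refine ⟨closedBall a (2 * (ε / 5)), mem_map.2 ?_, fun x hx y hy => ?_⟩
  · filter_upwards [hq, hf'] with r h1 h2
    rw [Real.dist_eq] at h2
    rw [mem_preimage, mem_closedBall, Real.dist_eq]
    calc |q r - a| ≤ |q r - f r| + |f r - a| := abs_sub_le _ _ _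
      _ ≤ _ := by linarith
  · have := dist_triangle_right x y a
    rw [mem_closedBall] at hx hy
    linarith

theorem exp_neg_mul_sq_mem_Icc {s : ℝ} (hs : 0 < s) (t : ℝ) :
    Real.exp (-s * t ^ 2) ∈ Icc (0 : ℝ) 1 :=
  ⟨(Real.exp_pos _).le, Real.exp_le_one_iff.2 (by rw [neg_mul, neg_nonpos]; positivity)⟩

/-- A continuous function which is `1` on `[exp (-1), 1]` and vanishes on `[0, exp (-l ^ 2)]`,
divided by its argument. -/
def cutoffQuotient (l y : ℝ) : ℝ :=
  max 0 (min 1 ((y - Real.exp (-l ^ 2)) / (Real.exp (-1) - Real.exp (-l ^ 2)))) /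
    max y (Real.exp (-l ^ 2))

theorem continuous_cutoffQuotient (l : ℝ) : Continuous (cutoffQuotient l) := by
  refine Continuous.div (by fun_prop) (by fun_prop) fun y => ?_
  exact ((Real.exp_pos _).trans_le (le_max_right _ _)).ne'

theorem mul_cutoffQuotient_nonneg {l y : ℝ} (hy : 0 ≤ y) : 0 ≤ y * cutoffQuotient l y :=
  mul_nonneg hy (div_nonneg (le_max_left _ _) (hy.trans (le_max_left _ _)))

theorem mul_cutoffQuotient_le_one {l y : ℝ} (hy : 0 ≤ y) : y * cutoffQuotient l y ≤ 1 := by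
  have h : 0 < max y (Real.exp (-l ^ 2)) := (Real.exp_pos _).trans_le (le_max_right _ _)
  rw [cutoffQuotient, ← mul_div_assoc, div_le_one h]
  exact (mul_le_of_le_one_right hy (max_le zero_le_one (min_le_left _ _))).trans (le_max_left _ _)

theorem mul_cutoffQuotient_eq_one {l y : ℝ} (hl : 1 < l) (hy : Real.exp (-1) ≤ y) :
    y * cutoffQuotient l y = 1 := by
  have h : Real.exp (-l ^ 2) < Real.exp (-1) := Real.exp_lt_exp.2 (by nlinarith)
  have hy0 : 0 < y := (Real.exp_pos _).trans_le hy
  rw [cutoffQuotient, max_eq_left (h.le.trans hy), min_eq_left, max_eq_right zero_le_one]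
  · field_simp
  · rw [one_le_div (sub_pos.2 h)]
    linarith

theorem cutoffQuotient_eq_zero {l y : ℝ} (hl : 1 < l) (hy : y ≤ Real.exp (-l ^ 2)) :
    cutoffQuotient l y = 0 := by
  have h : Real.exp (-l ^ 2) < Real.exp (-1) := Real.exp_lt_exp.2 (by nlinarith)
  rw [cutoffQuotient, max_eq_left, zero_div]
  exact (min_le_right _ _).trans (div_nonpos_of_nonpos_of_nonneg (by linarith) (by linarith))

namespace IsDistributionFunction

variable {d : ℕ} {μ : Measure (Euc d)} {φ : ℝ → ENNReal}

theorem integrable_gaussian_mul_comp (hφ : IsDistributionFunction μ φ) (h0 : 0 ∈ msupport μ)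
    {s : ℝ} (hs : 0 < s) {g : ℝ → ℝ} (hg : Continuous g) :
    Integrable (fun z => Real.exp (-s * ‖z‖ ^ 2) * g (Real.exp (-s * ‖z‖ ^ 2))) μ := by
  obtain ⟨M, hM⟩ := isCompact_Icc.exists_bound_of_continuousOn (hg.continuousOn (s := Icc 0 1))
  have hi0 : Integrable (fun z : Euc d => Real.exp (-s * ‖z‖ ^ 2)) μ := by
    simpa using hφ.integrable_pow_mul_gaussian h0 hs 0
  exact hi0.mul_bdd (c := M) (by fun_prop)
    (ae_of_all _ fun z => hM _ (exp_neg_mul_sq_mem_Icc hs _))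

theorem exists_tendsto_polynomial (hφ : IsDistributionFunction μ φ) (h0 : 0 ∈ msupport μ)
    {p c : ℝ} (hc : Tendsto (fun s : ℝ => s ^ (p / 2) * gaussianMass μ s)
      (nhdsWithin 0 (Ioi 0)) (nhds c)) (P : Polynomial ℝ) :
    ∃ a, Tendsto (fun s : ℝ => s ^ (p / 2) *
      ∫ z, Real.exp (-s * ‖z‖ ^ 2) * P.eval (Real.exp (-s * ‖z‖ ^ 2)) ∂μ)
      (nhdsWithin 0 (Ioi 0)) (nhds a) := by
  have hk : ∀ k : ℕ, Tendsto (fun s : ℝ => s ^ (p / 2) * gaussianMass μ ((k + 1) * s))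
      (nhdsWithin 0 (Ioi 0)) (nhds (((k : ℝ) + 1) ^ (-(p / 2)) * c)) := by
    intro k
    have hk0 : (0 : ℝ) < k + 1 := by positivity
    have h1 : Tendsto (fun s : ℝ => ((k : ℝ) + 1) * s) (nhdsWithin 0 (Ioi 0))
        (nhdsWithin 0 (Ioi 0)) := by
      refine tendsto_nhdsWithin_iff.2 ⟨?_, ?_⟩
      · have h2 : Continuous fun s : ℝ => ((k : ℝ) + 1) * s := by fun_prop
        simpa using (h2.tendsto 0).mono_left nhdsWithin_le_nhds
      · filter_upwards [self_mem_nhdsWithin] with s hs using mul_pos hk0 hs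
    refine ((hc.comp h1).const_mul _).congr' ?_
    filter_upwards [self_mem_nhdsWithin] with s hs
    have hs' : 0 < s := hs
    simp only [Function.comp]
    rw [Real.mul_rpow hk0.le hs'.le, Real.rpow_neg hk0.le]
    have : (0 : ℝ) < ((k : ℝ) + 1) ^ (p / 2) := by positivity
    field_simp
  refine ⟨_, (tendsto_finsetSum P.support fun k _ => (hk k).const_mul (P.coeff k)).congr' ?_⟩
  filter_upwards [self_mem_nhdsWithin] with s hs
  have hs' : 0 < s := hs
  have hpow : ∀ (k : ℕ) (z : Euc d), Real.exp (-s * ‖z‖ ^ 2) *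
      (P.coeff k * Real.exp (-s * ‖z‖ ^ 2) ^ k) =
      P.coeff k * Real.exp (-((k + 1) * s) * ‖z‖ ^ 2) := by
    intro k z
    rw [mul_left_comm, ← pow_succ', ← Real.exp_nat_mul]
    push_cast
    ring_nf
  have h_integrable : ∀ k ∈ P.support, Integrable (fun z : Euc d =>
      P.coeff k * Real.exp (-((k + 1) * s) * ‖z‖ ^ 2)) μ := by
    intro k _
    have := hφ.integrable_pow_mul_gaussian h0 (show 0 < ((k : ℝ) + 1) * s by positivity) 0
    simp only [pow_zero, one_mul] at this
    exact this.const_mul _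
  simp only [Polynomial.eval_eq_sum, Polynomial.sum, Finset.mul_sum, hpow]
  rw [integral_finsetSum _ h_integrable, Finset.mul_sum]
  refine Finset.sum_congr rfl fun k _ => ?_
  rw [integral_const_mul, gaussianMass]
  ring

theorem exists_tendsto_gaussian_mul_comp (hφ : IsDistributionFunction μ φ)
    (h0 : 0 ∈ msupport μ) {p c : ℝ} (hcpos : 0 < c)
    (hc : Tendsto (fun s : ℝ => s ^ (p / 2) * gaussianMass μ s)
      (nhdsWithin 0 (Ioi 0)) (nhds c)) {g : ℝ → ℝ} (hg : Continuous g) :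
    ∃ a, Tendsto (fun s : ℝ => s ^ (p / 2) *
      ∫ z, Real.exp (-s * ‖z‖ ^ 2) * g (Real.exp (-s * ‖z‖ ^ 2)) ∂μ)
      (nhdsWithin 0 (Ioi 0)) (nhds a) := by
  refine exists_tendsto_of_forall_approx fun ε hε => ?_
  obtain ⟨P, hP⟩ := exists_polynomial_near_of_continuousOn 0 1 g hg.continuousOn
    (ε / (2 * c)) (by positivity)
  obtain ⟨a, ha⟩ := hφ.exists_tendsto_polynomial h0 hc P
  refine ⟨_, a, ha, ?_⟩
  filter_upwards [self_mem_nhdsWithin, hc.eventually (gt_mem_nhds (show c < 2 * c by linarith))]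
    with s hs hs2
  have hs' : 0 < s := hs
  have hi0 : Integrable (fun z : Euc d => Real.exp (-s * ‖z‖ ^ 2)) μ := by
    simpa using hφ.integrable_pow_mul_gaussian h0 hs 0
  have hsp : 0 < s ^ (p / 2) := by positivity
  rw [← mul_sub, ← integral_sub (hφ.integrable_gaussian_mul_comp h0 hs' hg)
    (hφ.integrable_gaussian_mul_comp h0 hs' P.continuous), abs_mul, abs_of_pos hsp]
  have h1 : |∫ z, (Real.exp (-s * ‖z‖ ^ 2) * g (Real.exp (-s * ‖z‖ ^ 2)) -
      Real.exp (-s * ‖z‖ ^ 2) * P.eval (Real.exp (-s * ‖z‖ ^ 2))) ∂μ| ≤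
      ε / (2 * c) * gaussianMass μ s := by
    rw [gaussianMass, ← integral_const_mul, ← Real.norm_eq_abs]
    refine norm_integral_le_of_norm_le (hi0.const_mul _) (ae_of_all _ fun z => ?_)
    rw [← mul_sub, norm_mul, Real.norm_of_nonneg (Real.exp_pos _).le, mul_comm, norm_sub_rev]
    gcongr
    exact (hP _ (exp_neg_mul_sq_mem_Icc hs' _)).le
  calc _ ≤ s ^ (p / 2) * (ε / (2 * c) * gaussianMass μ s) := by gcongr
    _ = ε / (2 * c) * (s ^ (p / 2) * gaussianMass μ s) := by ring
    _ ≤ ε / (2 * c) * (2 * c) := by gcongr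
    _ = ε := by field_simp

theorem toReal_eq_integral_indicator (hφ : IsDistributionFunction μ φ) {x : Euc d}
    (hx : x ∈ msupport μ) {r : ℝ} (hr : 0 < r) :
    (φ r).toReal = ∫ z, (closedBall x r).indicator (fun _ => (1 : ℝ)) z ∂μ := by
  rw [← hφ.2.2 x hx r hr, integral_indicator_const _ isClosed_closedBall.measurableSet]
  simp [Measure.real]

theorem integrable_indicator_closedBall (hφ : IsDistributionFunction μ φ) {x : Euc d}
    (hx : x ∈ msupport μ) {r : ℝ} (hr : 0 < r) :
    Integrable ((closedBall x r).indicator (fun _ => (1 : ℝ))) μ := by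
  refine (integrable_indicator_iff isClosed_closedBall.measurableSet).2 (integrableOn_const ?_)
  rw [hφ.2.2 x hx r hr]
  exact (hφ.2.1 r hr).2.ne

theorem toReal_le_integral_cutoffQuotient (hφ : IsDistributionFunction μ φ)
    (h0 : 0 ∈ msupport μ) {l r : ℝ} (hl : 1 < l) (hr : 0 < r) :
    (φ r).toReal ≤ ∫ z, Real.exp (-(r ^ 2)⁻¹ * ‖z‖ ^ 2) *
      cutoffQuotient l (Real.exp (-(r ^ 2)⁻¹ * ‖z‖ ^ 2)) ∂μ := by
  rw [hφ.toReal_eq_integral_indicator h0 hr]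
  refine integral_mono (hφ.integrable_indicator_closedBall h0 hr)
    (hφ.integrable_gaussian_mul_comp h0 (by positivity) (continuous_cutoffQuotient l))
    fun z => ?_
  refine indicator_le' (g := fun z : Euc d => Real.exp (-(r ^ 2)⁻¹ * ‖z‖ ^ 2) *
      cutoffQuotient l (Real.exp (-(r ^ 2)⁻¹ * ‖z‖ ^ 2))) (fun z hz => ?_)
    (fun z _ => mul_cutoffQuotient_nonneg (Real.exp_pos _).le) z
  rw [mem_closedBall_zero_iff] at hz
  refine (mul_cutoffQuotient_eq_one hl (Real.exp_le_exp.2 ?_)).ge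
  have : (r ^ 2)⁻¹ * ‖z‖ ^ 2 ≤ (r ^ 2)⁻¹ * r ^ 2 := by gcongr
  rw [inv_mul_cancel₀ (by positivity)] at this
  linarith

theorem integral_cutoffQuotient_le (hφ : IsDistributionFunction μ φ)
    (h0 : 0 ∈ msupport μ) {l r : ℝ} (hl : 1 < l) (hr : 0 < r) :
    ∫ z, Real.exp (-(r ^ 2)⁻¹ * ‖z‖ ^ 2) *
      cutoffQuotient l (Real.exp (-(r ^ 2)⁻¹ * ‖z‖ ^ 2)) ∂μ ≤ (φ (l * r)).toReal := by
  have hlr : 0 < l * r := by positivity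
  rw [hφ.toReal_eq_integral_indicator h0 hlr]
  refine integral_mono
    (hφ.integrable_gaussian_mul_comp h0 (by positivity) (continuous_cutoffQuotient l))
    (hφ.integrable_indicator_closedBall h0 hlr) fun z => ?_
  by_cases hz : z ∈ closedBall (0 : Euc d) (l * r)
  · simp only [indicator_of_mem hz]
    exact mul_cutoffQuotient_le_one (Real.exp_pos _).le
  · simp only [indicator_of_notMem hz]
    rw [mem_closedBall_zero_iff, not_le] at hz
    rw [cutoffQuotient_eq_zero hl, mul_zero]
    refine Real.exp_le_exp.2 ?_
    have : (r ^ 2)⁻¹ * (l * r) ^ 2 ≤ (r ^ 2)⁻¹ * ‖z‖ ^ 2 := by gcongr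
    rw [mul_pow, mul_left_comm, inv_mul_cancel₀ (by positivity)] at this
    linarith

/-- The distribution function is asymptotic to a real power at infinity. -/
theorem exists_tendsto_div_rpow_atTop (hφ : IsDistributionFunction μ φ) (h0 : 0 ∈ msupport μ) :
    ∃ p c : ℝ, 0 < c ∧ Tendsto (fun r : ℝ => (φ r).toReal / r ^ p) atTop (nhds c) := by
  obtain ⟨p, c, hc, hpc⟩ := hφ.exists_tendsto_gaussianMass h0
  obtain ⟨C, hC, hCG⟩ := hφ.integral_gaussian_le
  refine ⟨p, exists_tendsto_pos_of_ratio fun η hη => ?_⟩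
  obtain ⟨l, hlη, hl⟩ : ∃ l : ℝ, l ^ p < η ∧ 1 < l := by
    have h1 : Tendsto (fun l : ℝ => l ^ p) (nhdsWithin 1 (Ioi 1)) (nhds 1) := by
      have := (Real.continuousAt_rpow_const 1 p (Or.inl one_ne_zero)).tendsto
      rw [Real.one_rpow] at this
      exact this.mono_left nhdsWithin_le_nhds
    exact ((h1.eventually (gt_mem_nhds hη)).and self_mem_nhdsWithin).exists
  have hl0 : 0 < l := one_pos.trans hl
  have hlp : 0 < l ^ p := by positivity
  have hinv : Tendsto (fun r : ℝ => (r ^ 2)⁻¹) atTop (nhdsWithin 0 (Ioi 0)) :=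
    tendsto_inv_atTop_nhdsGT_zero.comp (tendsto_pow_atTop two_ne_zero)
  obtain ⟨a, ha⟩ := hφ.exists_tendsto_gaussian_mul_comp h0 hc hpc (continuous_cutoffQuotient l)
  have hpow : ∀ r : ℝ, 0 < r → ((r ^ 2)⁻¹) ^ (p / 2) = (r ^ p)⁻¹ := by
    intro r hr
    rw [Real.inv_rpow (by positivity), ← Real.rpow_natCast, ← Real.rpow_mul hr.le]
    congr 2
    push_cast
    ring
  have hF := ha.comp hinv
  have hG := hpc.comp hinv
  set F : ℝ → ℝ := (fun s : ℝ => s ^ (p / 2) * ∫ z, Real.exp (-s * ‖z‖ ^ 2) *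
    cutoffQuotient l (Real.exp (-s * ‖z‖ ^ 2)) ∂μ) ∘ fun r : ℝ => (r ^ 2)⁻¹ with hFdef
  have hle : ∀ r : ℝ, 0 < r → (φ r).toReal / r ^ p ≤ F r := by
    intro r hr
    simp only [hFdef, Function.comp, hpow r hr]
    rw [div_eq_inv_mul]
    gcongr
    exact hφ.toReal_le_integral_cutoffQuotient h0 hl hr
  have hge : ∀ r : ℝ, 0 < r → F r ≤ l ^ p * ((φ (l * r)).toReal / (l * r) ^ p) := by
    intro r hr
    have hrp : 0 < r ^ p := by positivity
    simp only [hFdef, Function.comp, hpow r hr]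
    rw [Real.mul_rpow hl0.le hr.le]
    calc _ ≤ (r ^ p)⁻¹ * (φ (l * r)).toReal := by
          gcongr
          exact hφ.integral_cutoffQuotient_le h0 hl hr
      _ = _ := by field_simp
  have hGle : ∀ r : ℝ, 0 < r → ((r ^ 2)⁻¹) ^ (p / 2) * gaussianMass μ (r ^ 2)⁻¹ ≤
      C * ((φ r).toReal / r ^ p) := by
    intro r hr
    have h1 := hCG 0 h0 (r ^ 2)⁻¹ (by positivity)
    rw [Real.sqrt_inv, inv_inv, Real.sqrt_sq hr.le] at h1
    rw [hpow r hr, ← mul_div_assoc, div_eq_inv_mul]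
    simp only [sub_zero] at h1
    gcongr
    exact h1
  have hapos : 0 < a := by
    have h1 : c ≤ C * a := by
      refine le_of_tendsto_of_tendsto hG (hF.const_mul C) ?_
      filter_upwards [eventually_gt_atTop 0] with r hr
      refine (hGle r hr).trans ?_
      gcongr
      exact hle r hr
    exact pos_of_mul_pos_right (hc.trans_le h1) hC.le
  obtain ⟨a', haη, haa⟩ : ∃ a', a / η < a' ∧ a' < a / l ^ p :=
    exists_between (by gcongr)
  have ha' : 0 < a' := (by positivity : 0 < a / η).trans haη
  refine ⟨a', ha', ?_⟩
  have hdiv : Tendsto (fun r : ℝ => r / l) atTop atTop := tendsto_id.atTop_div_const hl0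
  filter_upwards [eventually_gt_atTop 0,
    hF.eventually (gt_mem_nhds (show a < η * a' by rwa [div_lt_iff₀' (by positivity)] at haη)),
    (hF.comp hdiv).eventually (lt_mem_nhds (show l ^ p * a' < a by
      rwa [lt_div_iff₀' hlp] at haa))] with r hr h1 h2
  refine ⟨?_, (hle r hr).trans h1.le⟩
  have h3 := hge (r / l) (by positivity)
  rw [mul_div_cancel₀ _ hl0.ne'] at h3
  exact le_of_mul_le_mul_left (h2.le.trans h3) hlp

end IsDistributionFunction

open scoped CompactlySupported

theorem exists_measure_of_bounded_functionals {α X : Type*} [TopologicalSpace X] [T2Space X]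
    [LocallyCompactSpace X] [MeasurableSpace X] [BorelSpace X] (U : Ultrafilter α)
    (L : α → C_c(X, ℝ) → ℝ)
    (hadd : ∀ f g, ∀ᶠ a in U, L a (f + g) = L a f + L a g)
    (hsmul : ∀ (c : ℝ) f, ∀ᶠ a in U, L a (c • f) = c * L a f)
    (hnonneg : ∀ f, 0 ≤ f → ∀ᶠ a in U, 0 ≤ L a f)
    (hbdd : ∀ f, ∃ M, ∀ᶠ a in U, |L a f| ≤ M) :
    ∃ ν : Measure X, ν.Regular ∧ ∀ f : C_c(X, ℝ), Tendsto (L · f) U (nhds (∫ x, f x ∂ν)) := by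
  have hlim : ∀ f, ∃ l, Tendsto (L · f) U (nhds l) := by
    intro f
    obtain ⟨M, hM⟩ := hbdd f
    obtain ⟨l, -, hl⟩ := (isCompact_Icc (a := -M) (b := M)).ultrafilter_le_nhds'
      (U.map (L · f)) (hM.mono fun a ha => abs_le.1 ha)
    exact ⟨l, hl⟩
  choose l hl using hlim
  let Λ₀ : C_c(X, ℝ) →ₗ[ℝ] ℝ :=
    { toFun := l
      map_add' := fun f g => tendsto_nhds_unique (hl (f + g))
        (((hl f).add (hl g)).congr' ((hadd f g).mono fun a ha => ha.symm))
      map_smul' := fun c f => tendsto_nhds_unique (hl (c • f))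
        (((hl f).const_mul c).congr' ((hsmul c f).mono fun a ha => ha.symm)) }
  let Λ : C_c(X, ℝ) →ₚ[ℝ] ℝ := PositiveLinearMap.mk₀ Λ₀ fun f hf =>
    ge_of_tendsto (hl f) (hnonneg f hf)
  refine ⟨RealRMK.rieszMeasure Λ, inferInstance, fun f => ?_⟩
  rw [RealRMK.integral_rieszMeasure]
  exact hl f

theorem exists_compactlySupported_cutoff {X : Type*} [PseudoMetricSpace X] [ProperSpace X] (x : X)
    {a b : ℝ} (hab : a < b) :
    ∃ f : C_c(X, ℝ), (∀ z, 0 ≤ f z ∧ f z ≤ 1) ∧ (∀ z ∈ closedBall x a, f z = 1) ∧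
      ∀ z ∉ closedBall x b, f z = 0 := by
  obtain ⟨f, h1, h0, hc, hf⟩ := exists_continuous_one_zero_of_isCompact
    (isCompact_closedBall x a) (isOpen_ball (x := x) (ε := b)).isClosed_compl
    (disjoint_compl_right_iff_subset.2 (closedBall_subset_ball hab))
  exact ⟨⟨f, hc⟩, hf, fun z hz => h1 hz, fun z hz => h0 fun hz' => hz (ball_subset_closedBall hz')⟩

namespace IsDistributionFunction

variable {d : ℕ} {μ : Measure (Euc d)} {φ : ℝ → ENNReal}

theorem integrable_comp_smul [IsLocallyFiniteMeasure μ] (f : C_c(Euc d, ℝ)) {r : ℝ} (hr : 0 < r) :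
    Integrable (fun z => f (r⁻¹ • z)) μ :=
  (f.continuous.comp (continuous_const_smul r⁻¹)).integrable_of_hasCompactSupport
    (f.hasCompactSupport.comp_homeomorph (Homeomorph.smulOfNeZero r⁻¹ (inv_ne_zero hr.ne')))

theorem integral_comp_smul_le [IsLocallyFiniteMeasure μ] (hφ : IsDistributionFunction μ φ)
    {f : C_c(Euc d, ℝ)} {x y : Euc d} {r ε b : ℝ} (hr : 0 < r) (hb : 0 < b + ε)
    (hy : y ∈ msupport μ) (hyx : ‖y - r • x‖ ≤ ε * r) (hf : ∀ z, f z ≤ 1)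
    (hfb : ∀ z ∉ closedBall x b, f z = 0) :
    ∫ z, f (r⁻¹ • z) ∂μ ≤ (φ ((b + ε) * r)).toReal := by
  have hbr : 0 < (b + ε) * r := by positivity
  rw [hφ.toReal_eq_integral_indicator hy hbr]
  refine integral_mono (integrable_comp_smul f hr)
    (hφ.integrable_indicator_closedBall hy hbr) fun z => ?_
  by_cases hz : z ∈ closedBall y ((b + ε) * r)
  · simp only [indicator_of_mem hz]
    exact hf _
  · simp only [indicator_of_notMem hz]
    refine (hfb _ fun hz' => hz ?_).le
    rw [mem_closedBall, dist_eq_norm] at hz' ⊢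
    have h1 : ‖z - r • x‖ ≤ b * r := by
      rw [show z - r • x = r • (r⁻¹ • z - x) by rw [smul_sub, smul_inv_smul₀ hr.ne'], norm_smul,
        Real.norm_of_nonneg hr.le, mul_comm]
      gcongr
    have h2 := norm_sub_le_norm_sub_add_norm_sub z (r • x) y
    rw [norm_sub_rev (r • x) y] at h2
    linarith

theorem le_integral_comp_smul [IsLocallyFiniteMeasure μ] (hφ : IsDistributionFunction μ φ)
    {f : C_c(Euc d, ℝ)} {x y : Euc d} {r ε a : ℝ} (hr : 0 < r) (ha : ε < a)
    (hy : y ∈ msupport μ) (hyx : ‖y - r • x‖ ≤ ε * r) (hf : ∀ z, 0 ≤ f z)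
    (hfa : ∀ z ∈ closedBall x a, f z = 1) :
    (φ ((a - ε) * r)).toReal ≤ ∫ z, f (r⁻¹ • z) ∂μ := by
  have har : 0 < (a - ε) * r := mul_pos (sub_pos.2 ha) hr
  rw [hφ.toReal_eq_integral_indicator hy har]
  refine integral_mono (hφ.integrable_indicator_closedBall hy har)
    (integrable_comp_smul f hr) fun z => ?_
  refine indicator_le' (g := fun z => f (r⁻¹ • z)) (fun z hz => (hfa _ ?_).ge)
    (fun z _ => hf _) z
  rw [mem_closedBall, dist_eq_norm] at hz ⊢
  have h2 := norm_sub_le_norm_sub_add_norm_sub z y (r • x)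
  rw [show r⁻¹ • z - x = r⁻¹ • (z - r • x) by rw [smul_sub, inv_smul_smul₀ hr.ne'], norm_smul,
    norm_inv, Real.norm_of_nonneg hr.le, inv_mul_le_iff₀ hr]
  linarith

theorem tendsto_inv_rpow_mul {p c : ℝ}
    (hc : Tendsto (fun r : ℝ => (φ r).toReal / r ^ p) atTop (nhds c)) {t : ℝ} (ht : 0 < t) :
    Tendsto (fun r : ℝ => (r ^ p)⁻¹ * (φ (t * r)).toReal) atTop (nhds (c * t ^ p)) := by
  refine ((hc.comp (tendsto_id.const_mul_atTop ht)).mul_const (t ^ p)).congr' ?_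
  filter_upwards [eventually_gt_atTop 0] with r hr
  have h1 : 0 < t ^ p := by positivity
  simp only [Function.comp, id, Real.mul_rpow ht.le hr.le]
  field_simp

/-- A measure which arises by blowing down a uniformly distributed measure. -/
theorem exists_blowdown [IsLocallyFiniteMeasure μ] (hφ : IsDistributionFunction μ φ)
    (h0 : 0 ∈ msupport μ) {p c : ℝ}
    (hc : Tendsto (fun r : ℝ => (φ r).toReal / r ^ p) atTop (nhds c)) (U : Ultrafilter ℝ)
    (hU : (U : Filter ℝ) ≤ atTop) :
    ∃ ν : Measure (Euc d), ν.Regular ∧ ∀ f : C_c(Euc d, ℝ),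
      Tendsto (fun r : ℝ => (r ^ p)⁻¹ * ∫ z, f (r⁻¹ • z) ∂μ) U (nhds (∫ x, f x ∂ν)) := by
  have hpos : ∀ᶠ r : ℝ in U, 0 < r := hU (eventually_gt_atTop 0)
  refine exists_measure_of_bounded_functionals U _ (fun f g => ?_) (fun a f => ?_)
    (fun f hf => ?_) (fun f => ?_)
  · filter_upwards [hpos] with r hr
    rw [← mul_add, ← integral_add (integrable_comp_smul f hr) (integrable_comp_smul g hr)]
    rfl
  · filter_upwards [hpos] with r hr
    rw [mul_left_comm, ← integral_const_mul a]
    rfl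
  · filter_upwards [hpos] with r hr
    exact mul_nonneg (by positivity) (integral_nonneg fun z => hf _)
  · obtain ⟨M, hM⟩ := f.hasCompactSupport.exists_bound_of_continuous f.continuous
    obtain ⟨R, hR0, hR⟩ := f.hasCompactSupport.isCompact.isBounded.subset_closedBall_lt 0 0
    obtain ⟨g, hg, hg1, hg0⟩ := exists_compactlySupported_cutoff (0 : Euc d) (lt_add_one R)
    have hM0 : 0 ≤ M := (norm_nonneg _).trans (hM 0)
    refine ⟨M * (c * (R + 1) ^ p + 1), ?_⟩
    filter_upwards [hpos, hU ((tendsto_inv_rpow_mul hc (show 0 < R + 1 by positivity)).eventually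
      (gt_mem_nhds (lt_add_one _)))] with r hr hr1
    have h1 : ∫ z, g (r⁻¹ • z) ∂μ ≤ (φ ((R + 1) * r)).toReal := by
      simpa using hφ.integral_comp_smul_le (f := g) (x := 0) (y := 0) (ε := 0) hr (by linarith) h0
        (by simp) (fun z => (hg z).2) hg0
    have h2 : |∫ z, f (r⁻¹ • z) ∂μ| ≤ M * ∫ z, g (r⁻¹ • z) ∂μ := by
      rw [← Real.norm_eq_abs, ← integral_const_mul]
      refine norm_integral_le_of_norm_le ((integrable_comp_smul g hr).const_mul M)
        (ae_of_all _ fun z => ?_)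
      by_cases hz : r⁻¹ • z ∈ tsupport f
      · rw [hg1 _ (hR hz), mul_one]
        exact hM _
      · rw [image_eq_zero_of_notMem_tsupport hz, norm_zero]
        exact mul_nonneg hM0 (hg _).1
    rw [abs_mul, abs_of_nonneg (by positivity)]
    calc _ ≤ (r ^ p)⁻¹ * (M * (φ ((R + 1) * r)).toReal) := by
          gcongr
          exact h2.trans (by gcongr)
      _ = M * ((r ^ p)⁻¹ * (φ ((R + 1) * r)).toReal) := by ring
      _ ≤ _ := by gcongr

end IsDistributionFunction

namespace IsDistributionFunction

variable {d : ℕ} {μ ν : Measure (Euc d)} {φ : ℝ → ENNReal}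

theorem isLocallyFiniteMeasure (hφ : IsDistributionFunction μ φ) (h0 : 0 ∈ msupport μ) :
    IsLocallyFiniteMeasure μ := by
  refine ⟨fun z => ⟨closedBall 0 (‖z‖ + 1), ?_, ?_⟩⟩
  · refine mem_of_superset (ball_mem_nhds z one_pos) fun y hy => ?_
    rw [mem_ball, dist_eq_norm] at hy
    rw [mem_closedBall_zero_iff]
    linarith [norm_le_norm_add_norm_sub' y z]
  · rw [hφ.2.2 0 h0 _ (by positivity)]
    exact (hφ.2.1 _ (by positivity)).2

theorem blowdown_closedBall [IsLocallyFiniteMeasure μ] (hφ : IsDistributionFunction μ φ)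
    {p c : ℝ} (hc : Tendsto (fun r : ℝ => (φ r).toReal / r ^ p) atTop (nhds c))
    {U : Ultrafilter ℝ} (hU : (U : Filter ℝ) ≤ atTop) (hν : ν.Regular)
    (hlim : ∀ f : C_c(Euc d, ℝ), Tendsto (fun r : ℝ => (r ^ p)⁻¹ * ∫ z, f (r⁻¹ • z) ∂μ) U
      (nhds (∫ x, f x ∂ν))) {x : Euc d}
    (hx : ∀ ε : ℝ, 0 < ε → ∀ᶠ r : ℝ in U, ∃ y ∈ msupport μ, ‖y - r • x‖ ≤ ε * r)
    {t : ℝ} (ht : 0 < t) : ν (closedBall x t) = ENNReal.ofReal (c * t ^ p) := by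
  have hpos : ∀ᶠ r : ℝ in U, 0 < r := hU (eventually_gt_atTop 0)
  have hfin : ν (closedBall x t) < ⊤ := (isCompact_closedBall x t).measure_lt_top
  have hind : Integrable ((closedBall x t).indicator fun _ => (1 : ℝ)) ν :=
    (integrable_indicator_iff isClosed_closedBall.measurableSet).2 (integrableOn_const hfin.ne)
  have hreal : ν.real (closedBall x t) =
      ∫ z, (closedBall x t).indicator (fun _ => (1 : ℝ)) z ∂ν := by
    rw [integral_indicator_const _ isClosed_closedBall.measurableSet, smul_eq_mul, mul_one]
  have h_integrable (f : C_c(Euc d, ℝ)) : Integrable f ν :=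
    f.continuous.integrable_of_hasCompactSupport f.hasCompactSupport
  have hupper : ∀ δ, 0 < δ → ν.real (closedBall x t) ≤ c * (t + δ) ^ p := by
    intro δ hδ
    obtain ⟨f, hf, hf1, hf0⟩ := exists_compactlySupported_cutoff x (show t < t + δ / 2 by linarith)
    calc ν.real (closedBall x t) ≤ ∫ z, f z ∂ν := by
          rw [hreal]
          refine integral_mono hind (h_integrable f) fun z => ?_
          exact indicator_le' (fun z hz => (hf1 z hz).ge) (fun z _ => (hf z).1) z
      _ ≤ c * (t + δ) ^ p := by
          refine le_of_tendsto_of_tendsto (hlim f)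
            ((tendsto_inv_rpow_mul hc (show 0 < t + δ by positivity)).mono_left hU) ?_
          filter_upwards [hpos, hx (δ / 2) (by positivity)] with r hr ⟨y, hy, hyx⟩
          gcongr
          have := hφ.integral_comp_smul_le hr (by positivity) hy hyx (fun z => (hf z).2) hf0
          rwa [add_assoc, add_halves] at this
  have hlower : ∀ δ, 0 < δ → δ < t → c * (t - δ) ^ p ≤ ν.real (closedBall x t) := by
    intro δ hδ hδt
    obtain ⟨f, hf, hf1, hf0⟩ := exists_compactlySupported_cutoff x (show t - δ / 2 < t by linarith)
    calc c * (t - δ) ^ p ≤ ∫ z, f z ∂ν := by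
          refine le_of_tendsto_of_tendsto
            ((tendsto_inv_rpow_mul hc (sub_pos.2 hδt)).mono_left hU) (hlim f) ?_
          filter_upwards [hpos, hx (δ / 2) (by positivity)] with r hr ⟨y, hy, hyx⟩
          gcongr
          have := hφ.le_integral_comp_smul hr (by linarith) hy hyx (fun z => (hf z).1) hf1
          rwa [sub_sub, add_halves] at this
      _ ≤ ν.real (closedBall x t) := by
          rw [hreal]
          refine integral_mono (h_integrable f) hind fun z => ?_
          by_cases hz : z ∈ closedBall x t
          · simpa only [indicator_of_mem hz] using (hf z).2
          · simpa only [indicator_of_notMem hz] using (hf0 z hz).le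
  have hcont (g : ℝ → ℝ) (hg : Continuous g) (hg0 : g 0 = t) :
      Tendsto (fun δ : ℝ => c * g δ ^ p) (nhdsWithin 0 (Ioi 0)) (nhds (c * t ^ p)) := by
    have h1 := (Real.continuousAt_rpow_const t p (Or.inl ht.ne')).tendsto.const_mul c
    have h2 : Tendsto g (nhds 0) (nhds t) := hg0 ▸ hg.tendsto 0
    exact (h1.comp h2).mono_left nhdsWithin_le_nhds
  have hle : ν.real (closedBall x t) ≤ c * t ^ p := by
    refine ge_of_tendsto (hcont (t + ·) (by fun_prop) (by simp)) ?_
    filter_upwards [self_mem_nhdsWithin] with δ hδ using hupper δ hδ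
  have hge : c * t ^ p ≤ ν.real (closedBall x t) := by
    refine le_of_tendsto (hcont (t - ·) (by fun_prop) (by simp)) ?_
    filter_upwards [Ioo_mem_nhdsGT ht] with δ hδ using hlower δ hδ.1 hδ.2
  rw [← le_antisymm hle hge, Measure.real, ENNReal.ofReal_toReal hfin.ne]

theorem eventually_exists_near_of_mem_msupport_blowdown {p : ℝ} {U : Ultrafilter ℝ}
    (hU : (U : Filter ℝ) ≤ atTop) (hν : ν.Regular)
    (hlim : ∀ f : C_c(Euc d, ℝ), Tendsto (fun r : ℝ => (r ^ p)⁻¹ * ∫ z, f (r⁻¹ • z) ∂μ) U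
      (nhds (∫ x, f x ∂ν))) {x : Euc d} (hx : x ∈ msupport ν) {ε : ℝ} (hε : 0 < ε) :
    ∀ᶠ r : ℝ in U, ∃ y ∈ msupport μ, ‖y - r • x‖ ≤ ε * r := by
  by_contra hcon
  rw [← Ultrafilter.eventually_not] at hcon
  obtain ⟨f, hf, hf1, hf0⟩ := exists_compactlySupported_cutoff x (half_lt_self hε)
  have hzero : ∫ z, f z ∂ν = 0 := by
    refine tendsto_nhds_unique (hlim f) (tendsto_const_nhds.congr' ?_)
    filter_upwards [hcon, hU (eventually_gt_atTop 0)] with r hr hr0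
    rw [integral_eq_zero_of_ae, mul_zero]
    filter_upwards [ae_mem_msupport μ] with z hz
    refine hf0 _ fun hz' => hr ⟨z, hz, ?_⟩
    rw [mem_closedBall, dist_eq_norm] at hz'
    rw [show z - r • x = r • (r⁻¹ • z - x) by rw [smul_sub, smul_inv_smul₀ hr0.ne'], norm_smul,
      Real.norm_of_nonneg (le_of_lt hr0), mul_comm]
    exact mul_le_mul_of_nonneg_right hz' (le_of_lt hr0)
  have h_integrable : Integrable f ν := f.continuous.integrable_of_hasCompactSupport f.hasCompactSupport
  rw [integral_eq_zero_iff_of_nonneg (fun z => (hf z).1) h_integrable] at hzero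
  refine (hx (ε / 2) (half_pos hε)).ne' (measure_mono_null (fun z hz => ?_) hzero)
  simp [hf1 z hz]

/-- The distribution function has an integer dimension at infinity. -/
theorem exists_hasDimInfty [IsLocallyFiniteMeasure μ] (hφ : IsDistributionFunction μ φ)
    (h0 : 0 ∈ msupport μ) : ∃ n ≤ d, HasDimInfty φ n := by
  obtain ⟨p, c, hcpos, hc⟩ := hφ.exists_tendsto_div_rpow_atTop h0
  obtain ⟨ν, hν, hlim⟩ := hφ.exists_blowdown h0 hc (Ultrafilter.of atTop) (Ultrafilter.of_le _)
  have hball : ∀ x : Euc d, (∀ ε : ℝ, 0 < ε → ∀ᶠ r : ℝ in (Ultrafilter.of atTop : Ultrafilter ℝ),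
      ∃ y ∈ msupport μ, ‖y - r • x‖ ≤ ε * r) → ∀ t : ℝ, 0 < t →
      ν (closedBall x t) = ENNReal.ofReal (c * t ^ p) := fun x hx t ht =>
    hφ.blowdown_closedBall hc (Ultrafilter.of_le _) hν hlim hx ht
  have hν0 : 0 ∈ msupport ν := by
    intro t ht
    rw [hball 0 (fun ε hε => ?_) t ht, ENNReal.ofReal_pos]
    · positivity
    · filter_upwards [Ultrafilter.of_le _ (eventually_gt_atTop 0)] with r hr
      exact ⟨0, h0, by simpa using (mul_pos hε hr).le⟩
  have hψ : IsDistributionFunction ν fun t => ENNReal.ofReal (c * t ^ p) := by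
    refine ⟨⟨0, hν0⟩, fun t ht => ⟨ENNReal.ofReal_pos.2 (by positivity), ENNReal.ofReal_lt_top⟩,
      fun x hx t ht => hball x (fun ε hε => ?_) t ht⟩
    exact eventually_exists_near_of_mem_msupport_blowdown (Ultrafilter.of_le _) hν hlim hx hε
  obtain ⟨n, hn, b, hb, hbn⟩ := hψ.exists_hasDim0 hν0
  have hdouble : Tendsto (fun t : ℝ => 2 * t) (nhdsWithin 0 (Ioi 0)) (nhdsWithin 0 (Ioi 0)) := by
    refine tendsto_nhdsWithin_iff.2 ⟨?_, ?_⟩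
    · have h2 : Continuous fun t : ℝ => 2 * t := by fun_prop
      simpa using (h2.tendsto 0).mono_left nhdsWithin_le_nhds
    · filter_upwards [self_mem_nhdsWithin] with t (ht : 0 < t) using mul_pos two_pos ht
  have hratio : b = (2 : ℝ) ^ p / 2 ^ n * b := by
    refine tendsto_nhds_unique (hbn.comp hdouble) ((hbn.const_mul _).congr' ?_)
    filter_upwards [self_mem_nhdsWithin] with t ht
    have ht' : 0 < t := ht
    simp only [Function.comp]
    rw [ENNReal.toReal_ofReal (by positivity), ENNReal.toReal_ofReal (by positivity),
      Real.mul_rpow two_pos.le ht'.le, mul_pow]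
    field_simp
  have hpn : p = n := by
    have h1 : (2 : ℝ) ^ p / 2 ^ n = 1 := mul_right_cancel₀ hb.ne' (by rw [one_mul, ← hratio])
    rw [div_eq_one_iff_eq (by positivity), ← Real.rpow_natCast] at h1
    exact (Real.rpow_right_inj two_pos (by norm_num)).1 h1
  refine ⟨n, hn, c, hcpos, ?_⟩
  simpa only [hpn, Real.rpow_natCast] using hc

end IsDistributionFunction

theorem dimensions_exist {d : ℕ}
    (μ : Measure (Euc d)) [IsLocallyFiniteMeasure μ]
    (φ : ℝ → ENNReal) (hφ : IsDistributionFunction μ φ) :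
    ∃ n p : ℕ, n ≤ d ∧ p ≤ d ∧ HasDim0 φ n ∧ HasDimInfty φ p := by
  obtain ⟨x, hx⟩ := hφ.1
  obtain ⟨hψ, hsupp⟩ := hφ.map_sub x
  have h0 := hsupp x hx
  rw [sub_self] at h0
  have : IsLocallyFiniteMeasure (μ.map fun z => z - x) :=
    hψ.isLocallyFiniteMeasure h0
  obtain ⟨n, hn, hn0⟩ := hψ.exists_hasDim0 h0
  obtain ⟨p, hp, hp0⟩ := hψ.exists_hasDimInfty h0
  exact ⟨n, p, hn, hp, hn0, hp0⟩
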